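/- arXiv:1909.05570 — 5 statements merged into one kernel-verified Lean document; each statement's English description precedes it below -/
import Mathlib

section
/- The function L : ℝ → ℝ defined by L(λ) = (-1+√(1+4λ²))/2 - (1/2) log((1+√(1+4λ²))/4) is infinitely differentiable on ℝ, satisfies L'(λ) = r_0(λ) ∈ (-1,1) for every λ ∈ ℝ, is strictly convex on ℝ (its second derivative is L''(λ) = (1/(2λ²))(1 - 1/√(1+4λ²)) > 0 for λ ≠ 0, extended by continuity to L''(0) = 1), and attains its minimum at λ = 0. -/
open Real Filter

/-- The saddle point `r₀(λ)`, unique root of `h_λ'(r) = 0` in `(-1,1)`. -/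
noncomputable def r0 (l : ℝ) : ℝ :=
  if l = 0 then 0 else (-1 + Real.sqrt (1 + 4 * l ^ 2)) / (2 * l)

/-- The limiting normalized cumulant generating function `L`. -/
noncomputable def Lfun (l : ℝ) : ℝ :=
  (-1 + Real.sqrt (1 + 4 * l ^ 2)) / 2
    - (1 / 2) * Real.log ((1 + Real.sqrt (1 + 4 * l ^ 2)) / 4)

lemma sqrt_one_add_four_mul_sq_pos (l : ℝ) : 0 < √(1 + 4 * l ^ 2) :=
  Real.sqrt_pos.mpr (by positivity)

lemma sq_sqrt_one_add_four_mul_sq (l : ℝ) : √(1 + 4 * l ^ 2) ^ 2 = 1 + 4 * l ^ 2 :=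
  Real.sq_sqrt (by positivity)

lemma r0_eq (l : ℝ) : r0 l = 2 * l / (1 + √(1 + 4 * l ^ 2)) := by
  have hs := sqrt_one_add_four_mul_sq_pos l
  have hq := sq_sqrt_one_add_four_mul_sq l
  unfold r0
  split_ifs with h
  · simp [h]
  · rw [div_eq_div_iff (by simpa using h) (by positivity)]
    linear_combination hq

lemma r0_mem_Ioo (l : ℝ) : r0 l ∈ Set.Ioo (-1 : ℝ) 1 := by
  have hs := sqrt_one_add_four_mul_sq_pos l
  have hq := sq_sqrt_one_add_four_mul_sq l
  rw [r0_eq, Set.mem_Ioo, lt_div_iff₀ (by positivity), div_lt_one (by positivity)]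
  constructor <;> nlinarith

lemma hasDerivAt_sqrt_one_add_four_mul_sq (l : ℝ) :
    HasDerivAt (fun x : ℝ => √(1 + 4 * x ^ 2)) (4 * l / √(1 + 4 * l ^ 2)) l := by
  have hs := sqrt_one_add_four_mul_sq_pos l
  refine ((((hasDerivAt_pow 2 l).const_mul 4).const_add 1).sqrt (by positivity)).congr_deriv ?_
  field_simp
  norm_num [mul_comm]

lemma hasDerivAt_Lfun (l : ℝ) : HasDerivAt Lfun (r0 l) l := by
  have hs := sqrt_one_add_four_mul_sq_pos l
  have hd := hasDerivAt_sqrt_one_add_four_mul_sq l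
  refine (((hd.const_add (-1)).div_const 2).sub
    ((((hd.const_add 1).div_const 4).log (by positivity)).const_mul (1 / 2))).congr_deriv ?_
  rw [r0_eq]
  field_simp
  ring

lemma deriv_Lfun : deriv Lfun = r0 :=
  funext fun l => (hasDerivAt_Lfun l).deriv

lemma hasDerivAt_r0 (l : ℝ) :
    HasDerivAt r0 (2 / (√(1 + 4 * l ^ 2) * (1 + √(1 + 4 * l ^ 2)))) l := by
  have hs := sqrt_one_add_four_mul_sq_pos l
  have hq := sq_sqrt_one_add_four_mul_sq l
  have hd := hasDerivAt_sqrt_one_add_four_mul_sq l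
  rw [funext r0_eq]
  refine (((hasDerivAt_id l).const_mul 2).div (hd.const_add 1) (by positivity)).congr_deriv ?_
  simp only [id_eq]
  field_simp
  linear_combination hq

lemma deriv_r0_pos (l : ℝ) : 0 < deriv r0 l := by
  have hs := sqrt_one_add_four_mul_sq_pos l
  rw [(hasDerivAt_r0 l).deriv]
  positivity

lemma contDiff_Lfun {n : WithTop ℕ∞} : ContDiff ℝ n Lfun := by
  have hs : ContDiff ℝ n fun x : ℝ => √(1 + 4 * x ^ 2) :=
    ContDiff.sqrt (by fun_prop) fun x => by positivity
  refine ((contDiff_const.add hs).div_const 2).sub (contDiff_const.mul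
    (((contDiff_const.add hs).div_const 4).log fun x => ?_))
  positivity

lemma strictConvexOn_Lfun : StrictConvexOn ℝ Set.univ Lfun := by
  refine StrictMono.strictConvexOn_univ_of_deriv (contDiff_Lfun (n := 0)).continuous ?_
  rw [deriv_Lfun]
  exact strictMono_of_deriv_pos deriv_r0_pos

lemma isMinOn_Lfun : IsMinOn Lfun Set.univ 0 := by
  refine strictConvexOn_Lfun.convexOn.isMinOn_of_rightDeriv_eq_zero (by simp) ?_
  rw [(hasDerivAt_Lfun 0).hasDerivWithinAt.derivWithin (uniqueDiffWithinAt_Ioi 0)]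
  simp [r0]

theorem stmt_1 :
    ContDiff ℝ (⊤ : ℕ∞) Lfun ∧
    (∀ l : ℝ, deriv Lfun l = r0 l ∧ r0 l ∈ Set.Ioo (-1 : ℝ) 1) ∧
    StrictConvexOn ℝ Set.univ Lfun ∧
    (∀ l : ℝ, l ≠ 0 →
      deriv (deriv Lfun) l = (1 / (2 * l ^ 2)) * (1 - 1 / Real.sqrt (1 + 4 * l ^ 2)) ∧
      0 < deriv (deriv Lfun) l) ∧
    deriv (deriv Lfun) 0 = 1 ∧
    IsMinOn Lfun Set.univ 0 := by
  refine ⟨contDiff_Lfun, fun l => ⟨congrFun deriv_Lfun l, r0_mem_Ioo l⟩, strictConvexOn_Lfun,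
    fun l hl => ?_, ?_, isMinOn_Lfun⟩
  · rw [deriv_Lfun]
    refine ⟨?_, deriv_r0_pos l⟩
    have hs := sqrt_one_add_four_mul_sq_pos l
    have hq := sq_sqrt_one_add_four_mul_sq l
    rw [(hasDerivAt_r0 l).deriv]
    field_simp
    linear_combination -hq
  · rw [deriv_Lfun, (hasDerivAt_r0 0).deriv]
    norm_num
end

section
/- For every c ∈ (0,1), as n → ∞, Γ((n-1)/2)/(√π · Γ((n-2)/2)) · ∫_{c}^{1} (1-r²)^{(n-4)/2} dr = (1-c²)^{n/2} · (1+4λ_c²)^{-1/4} · ((1+√(1+4λ_c²))/2)^{3/2} / (λ_c σ_c √(2πn)) · (1 + o(1)), where λ_c = c/(1-c²) and σ_c = (1-c²)/√(1+c²). (The left-hand side is P(r_n ≥ c) for the empirical Pearson coefficient r_n in the spherical model, and (1-c²)^{n/2} = e^{-n L*(c)} with rate function L*(c) = -(1/2)log(1-c²).) -/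
open Real Filter

/-- The half-integer shift of the Gamma function: `Γ(x + 1/2) / Γ(x) ∼ √x`. -/
theorem tendsto_Gamma_add_half_div_atTop :
    Tendsto (fun x : ℝ => Real.Gamma (x + 1 / 2) / (Real.Gamma x * √x)) atTop (nhds 1) := by
  have geom_mean_bound : ∀ y : ℝ, 0 < y → Real.Gamma (y + 1 / 2) ≤ Real.Gamma y * √y := by
    intro y hy
    have h := Real.Gamma_mul_add_mul_le_rpow_Gamma_mul_rpow_Gamma hy (by linarith : 0 < y + 1)
      (by norm_num : (0 : ℝ) < 1 / 2) (by norm_num : (0 : ℝ) < 1 / 2) (by norm_num)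
    have hG := Real.Gamma_pos_of_pos hy
    rw [Real.Gamma_add_one hy.ne', ← Real.sqrt_eq_rpow, ← Real.sqrt_eq_rpow,
      Real.sqrt_mul hy.le] at h
    calc Real.Gamma (y + 1 / 2) = Real.Gamma (1 / 2 * y + 1 / 2 * (y + 1)) := by ring_nf
      _ ≤ _ := h
      _ = (√(Real.Gamma y) * √(Real.Gamma y)) * √y := by ring
      _ = _ := by rw [Real.mul_self_sqrt hG.le]
  have hlim : Tendsto (fun x : ℝ => √(x / (x + 1 / 2))) atTop (nhds 1) := by
    have h : Tendsto (fun x : ℝ => 1 - (1 / 2) / (x + 1 / 2)) atTop (nhds (1 - 0)) :=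
      tendsto_const_nhds.sub
        ((tendsto_atTop_add_const_right _ _ tendsto_id).const_div_atTop _)
    rw [sub_zero] at h
    have h' := h.sqrt
    rw [Real.sqrt_one] at h'
    refine h'.congr' ?_
    filter_upwards [eventually_gt_atTop 0] with x hx
    congr 1
    field_simp
    ring
  refine tendsto_of_tendsto_of_tendsto_of_le_of_le' hlim tendsto_const_nhds ?_ ?_
  · filter_upwards [eventually_gt_atTop 0] with x hx
    have hG := Real.Gamma_pos_of_pos hx
    have hs := Real.sqrt_pos.2 hx
    have hs' : 0 < √(x + 1 / 2) := Real.sqrt_pos.2 (by linarith)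
    have h := geom_mean_bound (x + 1 / 2) (by linarith)
    rw [show x + 1 / 2 + 1 / 2 = x + 1 by ring, Real.Gamma_add_one hx.ne'] at h
    rw [Real.sqrt_div hx.le, div_le_div_iff₀ hs' (by positivity)]
    calc √x * (Real.Gamma x * √x) = (√x * √x) * Real.Gamma x := by ring
      _ = x * Real.Gamma x := by rw [Real.mul_self_sqrt hx.le]
      _ ≤ _ := h
  · filter_upwards [eventually_gt_atTop 0] with x hx
    have hG := Real.Gamma_pos_of_pos hx
    have hs := Real.sqrt_pos.2 hx
    rw [div_le_one (by positivity)]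
    exact geom_mean_bound x hx

/-- Integration by parts for the tail integral of `(1 - r²)^(x - 1)`. -/
theorem integral_one_sub_sq_rpow_add {c x : ℝ} (hc : c ∈ Set.Ioo (0 : ℝ) 1) (hx : 1 < x) :
    (∫ r in c..(1 : ℝ), (1 - r ^ 2) ^ (x - 1)) +
      ∫ r in c..(1 : ℝ), (1 - r ^ 2) ^ x / (2 * x * r ^ 2) = (1 - c ^ 2) ^ x / (2 * x * c) := by
  obtain ⟨hc0, hc1⟩ := hc
  have hpos : ∀ r ∈ Set.uIcc c 1, 0 < r := fun r hr => by
    rw [Set.uIcc_of_le hc1.le] at hr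
    exact hc0.trans_le hr.1
  have hcont : ∀ p : ℝ, 0 ≤ p → Continuous fun r : ℝ => (1 - r ^ 2) ^ p := fun p hp =>
    (by fun_prop : Continuous fun r : ℝ => 1 - r ^ 2).rpow_const fun _ => Or.inr hp
  have hcont' : ContinuousOn (fun r : ℝ => (1 - r ^ 2) ^ x / (2 * x * r ^ 2)) (Set.uIcc c 1) :=
    (hcont x (by linarith)).continuousOn.div (by fun_prop) fun r hr => by
      have := hpos r hr
      positivity
  have hint := (hcont (x - 1) (by linarith)).intervalIntegrable (μ := MeasureTheory.volume) c 1
  rw [← intervalIntegral.integral_add hint hcont'.intervalIntegrable]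
  rw [intervalIntegral.integral_eq_sub_of_hasDerivAt
    (f := fun r => -((1 - r ^ 2) ^ x / (2 * x * r))) ?_ (hint.add hcont'.intervalIntegrable)]
  · simp [Real.zero_rpow (by linarith : x ≠ 0)]
  · intro r hr
    have hr0 := hpos r hr
    have h1 : HasDerivAt (fun r : ℝ => 1 - r ^ 2) (-(2 * r)) r := by
      simpa using (hasDerivAt_pow 2 r).const_sub 1
    have h2 := (h1.rpow_const (p := x) (Or.inr hx.le)).div
      ((hasDerivAt_id r).const_mul (2 * x)) (by simp only [id]; positivity)
    refine h2.neg.congr_deriv ?_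
    simp only [id]
    field_simp
    ring

theorem integral_one_sub_sq_rpow_le {c x : ℝ} (hc : c ∈ Set.Ioo (0 : ℝ) 1) (hx : 1 < x) :
    ∫ r in c..(1 : ℝ), (1 - r ^ 2) ^ (x - 1) ≤ (1 - c ^ 2) ^ x / (2 * x * c) := by
  rw [← integral_one_sub_sq_rpow_add hc hx]
  refine le_add_of_nonneg_right (intervalIntegral.integral_nonneg hc.2.le fun r hr => ?_)
  have h0 : 0 ≤ 1 - r ^ 2 := by nlinarith [hr.1, hr.2, hc.1]
  positivity

theorem le_integral_one_sub_sq_rpow {c x : ℝ} (hc : c ∈ Set.Ioo (0 : ℝ) 1) (hx : 1 < x) :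
    (1 - c ^ 2) ^ x / (2 * x * c) ≤
      (1 + 1 / (2 * c ^ 2) / x) * ∫ r in c..(1 : ℝ), (1 - r ^ 2) ^ (x - 1) := by
  obtain ⟨hc0, hc1⟩ := hc
  have hcont : ∀ p : ℝ, 0 ≤ p → Continuous fun r : ℝ => (1 - r ^ 2) ^ p := fun p hp =>
    (by fun_prop : Continuous fun r : ℝ => 1 - r ^ 2).rpow_const fun _ => Or.inr hp
  rw [← integral_one_sub_sq_rpow_add ⟨hc0, hc1⟩ hx, add_mul, one_mul,
    ← intervalIntegral.integral_const_mul]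
  gcongr
  refine intervalIntegral.integral_mono_on hc1.le ?_ ?_ fun r hr => ?_
  · refine ContinuousOn.intervalIntegrable ?_
    refine (hcont x (by linarith)).continuousOn.div (by fun_prop) fun r hr => ?_
    rw [Set.uIcc_of_le hc1.le] at hr
    have := hc0.trans_le hr.1
    positivity
  · exact (continuous_const.mul (hcont (x - 1) (by linarith))).intervalIntegrable _ _
  · have hr0 : 0 < r := hc0.trans_le hr.1
    have h0 : 0 ≤ 1 - r ^ 2 := by nlinarith [hr.1, hr.2]
    have h1 : (1 - r ^ 2) ^ x ≤ (1 - r ^ 2) ^ (x - 1) :=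
      Real.rpow_le_rpow_of_exponent_ge' h0 (by nlinarith) (by linarith) (by linarith)
    calc (1 - r ^ 2) ^ x / (2 * x * r ^ 2) ≤ (1 - r ^ 2) ^ (x - 1) / (2 * x * c ^ 2) := by
          gcongr
          exact hr.1
      _ = _ := by field_simp

theorem tendsto_integral_one_sub_sq_rpow_div {c : ℝ} (hc : c ∈ Set.Ioo (0 : ℝ) 1) :
    Tendsto (fun x : ℝ => (∫ r in c..(1 : ℝ), (1 - r ^ 2) ^ (x - 1)) /
      ((1 - c ^ 2) ^ x / (2 * x * c))) atTop (nhds 1) := by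
  have hc0 := hc.1
  have hlim : Tendsto (fun x : ℝ => (1 + 1 / (2 * c ^ 2) / x)⁻¹) atTop (nhds 1) := by
    have h : Tendsto (fun x : ℝ => 1 + 1 / (2 * c ^ 2) / x) atTop (nhds (1 + 0)) :=
      tendsto_const_nhds.add (tendsto_id.const_div_atTop _)
    simpa using h.inv₀ (by norm_num)
  have hb : 0 < 1 - c ^ 2 := by nlinarith [hc.1, hc.2]
  refine tendsto_of_tendsto_of_tendsto_of_le_of_le' hlim tendsto_const_nhds ?_ ?_
  · filter_upwards [eventually_gt_atTop 1] with x hx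
    have hx0 : 0 < x := by linarith
    rw [le_div_iff₀ (by positivity), inv_mul_le_iff₀ (by positivity)]
    exact le_integral_one_sub_sq_rpow hc hx
  · filter_upwards [eventually_gt_atTop 1] with x hx
    have hx0 : 0 < x := by linarith
    rw [div_le_one (by positivity)]
    exact integral_one_sub_sq_rpow_le hc hx

/-- Simplified form of the sharp large deviation prefactor. -/
theorem pearson_prefactor_eq {c : ℝ} (hc : c ∈ Set.Ioo (0 : ℝ) 1) (t : ℝ) :
    (1 - c ^ 2) ^ (t / 2)
        * (1 + 4 * (c / (1 - c ^ 2)) ^ 2) ^ (-(1 / 4) : ℝ)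
        * ((1 + Real.sqrt (1 + 4 * (c / (1 - c ^ 2)) ^ 2)) / 2) ^ ((3 : ℝ) / 2)
        / ((c / (1 - c ^ 2)) * ((1 - c ^ 2) / Real.sqrt (1 + c ^ 2))
            * Real.sqrt (2 * π * t))
      = (1 - c ^ 2) ^ ((t - 2) / 2) / (c * √(2 * π * t)) := by
  have hc0 := hc.1
  have hb : 0 < 1 - c ^ 2 := by nlinarith [hc.1, hc.2]
  have ha : 0 < 1 + c ^ 2 := by positivity
  have hsq : 1 + 4 * (c / (1 - c ^ 2)) ^ 2 = ((1 + c ^ 2) / (1 - c ^ 2)) ^ 2 := by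
    field_simp
    ring
  have hhalf : (1 + (1 + c ^ 2) / (1 - c ^ 2)) / 2 = (1 - c ^ 2)⁻¹ := by
    field_simp
    ring
  rw [hsq, Real.sqrt_sq (by positivity), hhalf, ← Real.rpow_natCast_mul (by positivity),
    show ((2 : ℕ) : ℝ) * (-(1 / 4)) = -(1 / 2) by norm_num, Real.div_rpow ha.le hb.le,
    Real.inv_rpow hb.le, ← Real.rpow_neg hb.le (3 / 2), Real.sqrt_eq_rpow (1 + c ^ 2),
    Real.rpow_neg ha.le, Real.rpow_neg hb.le (1 / 2)]
  have key : (1 - c ^ 2) ^ ((t - 2) / 2)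
      = (1 - c ^ 2) ^ (t / 2) * (1 - c ^ 2) ^ ((1 : ℝ) / 2) * (1 - c ^ 2) ^ (-((3 : ℝ) / 2)) := by
    rw [← Real.rpow_add hb, ← Real.rpow_add hb]
    congr 1
    ring
  rw [key]
  have h1 : (1 + c ^ 2) ^ ((1 : ℝ) / 2) ≠ 0 := (Real.rpow_pos_of_pos ha _).ne'
  have h2 : (1 - c ^ 2) ^ ((1 : ℝ) / 2) ≠ 0 := (Real.rpow_pos_of_pos hb _).ne'
  generalize (1 + c ^ 2) ^ ((1 : ℝ) / 2) = u at *
  generalize (1 - c ^ 2) ^ ((1 : ℝ) / 2) = v at *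
  generalize √(2 * π * t) = w at *
  rcases eq_or_ne w 0 with rfl | hw
  · simp
  · field_simp

/-- The tail probability divided by its equivalent, with `x = (n - 2) / 2`. -/
theorem pearson_tail_div_equivalent {c x : ℝ} (hc : c ∈ Set.Ioo (0 : ℝ) 1) (hx : 1 < x) (I : ℝ) :
    Real.Gamma (x + 1 / 2) / (√π * Real.Gamma x) * I /
        ((1 - c ^ 2) ^ x / (c * √(2 * π * (2 * x + 2))))
      = Real.Gamma (x + 1 / 2) / (Real.Gamma x * √x) * (I / ((1 - c ^ 2) ^ x / (2 * x * c)))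
          * √(1 + 1 / x) := by
  have hc0 := hc.1
  have hx0 : 0 < x := by linarith
  have hb : 0 < 1 - c ^ 2 := by nlinarith [hc.1, hc.2]
  have hB := (Real.rpow_pos_of_pos hb x).ne'
  have hG := (Real.Gamma_pos_of_pos hx0).ne'
  have hs := (Real.sqrt_pos.2 hx0).ne'
  have hπ := (Real.sqrt_pos.2 Real.pi_pos).ne'
  have e1 : √(2 * π * (2 * x + 2)) = 2 * √π * √(x + 1) := by
    rw [show 2 * π * (2 * x + 2) = 2 ^ 2 * π * (x + 1) by ring, Real.sqrt_mul (by positivity),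
      Real.sqrt_mul (by positivity), Real.sqrt_sq (by norm_num)]
  have e2 : √(1 + 1 / x) = √(x + 1) / √x := by
    rw [← Real.sqrt_div (by positivity)]
    congr 1
    field_simp
  rw [e1, e2]
  generalize (1 - c ^ 2) ^ x = B at *
  field_simp
  rw [Real.sq_sqrt hx0.le, mul_comm]

theorem stmt_4 (c : ℝ) (hc : c ∈ Set.Ioo (0 : ℝ) 1) :
    ∃ ε : ℕ → ℝ, Tendsto ε atTop (nhds 0) ∧
      ∀ᶠ n : ℕ in atTop,
        Real.Gamma (((n : ℝ) - 1) / 2) / (Real.sqrt π * Real.Gamma (((n : ℝ) - 2) / 2)) *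
            ∫ r in c..(1 : ℝ), (1 - r ^ 2) ^ (((n : ℝ) - 4) / 2)
          = (1 - c ^ 2) ^ ((n : ℝ) / 2)
              * (1 + 4 * (c / (1 - c ^ 2)) ^ 2) ^ (-(1 / 4) : ℝ)
              * ((1 + Real.sqrt (1 + 4 * (c / (1 - c ^ 2)) ^ 2)) / 2) ^ ((3 : ℝ) / 2)
              / ((c / (1 - c ^ 2)) * ((1 - c ^ 2) / Real.sqrt (1 + c ^ 2))
                  * Real.sqrt (2 * π * n))
              * (1 + ε n) := by
  have hc0 := hc.1
  have hb : 0 < 1 - c ^ 2 := by nlinarith [hc.1, hc.2]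
  have hsqrt : Tendsto (fun x : ℝ => √(1 + 1 / x)) atTop (nhds 1) := by
    have h : Tendsto (fun x : ℝ => 1 + 1 / x) atTop (nhds (1 + 0)) :=
      tendsto_const_nhds.add (tendsto_id.const_div_atTop _)
    simpa using h.sqrt
  have hlim := (tendsto_Gamma_add_half_div_atTop.mul
    (tendsto_integral_one_sub_sq_rpow_div hc)).mul hsqrt
  have hnat : Tendsto (fun n : ℕ => ((n : ℝ) - 2) / 2) atTop atTop :=
    (tendsto_atTop_add_const_right _ (-2) tendsto_natCast_atTop_atTop).atTop_div_const
      (by norm_num)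
  have hε := (hlim.comp hnat).sub_const 1
  simp only [mul_one, sub_self] at hε
  refine ⟨_, hε, ?_⟩
  filter_upwards [hnat.eventually_gt_atTop 1] with n hn
  have hn0 : (0 : ℝ) < n := by linarith
  rw [pearson_prefactor_eq hc, add_sub_cancel, Function.comp_apply,
    ← pearson_tail_div_equivalent hc hn, show 2 * (((n : ℝ) - 2) / 2) + 2 = n by ring,
    show ((n : ℝ) - 2) / 2 + 1 / 2 = (n - 1) / 2 by ring,
    show ((n : ℝ) - 2) / 2 - 1 = (n - 4) / 2 by ring, mul_div_cancel₀]
  have := Real.pi_pos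
  positivity
end

section
/- Fix c ∈ (0,1), λ_c = c/(1-c²) and σ_c = (1-c²)/√(1+c²). For n > 4 and u ∈ ℝ define the tilted characteristic function Φ_n(u) = e^{-i u c √n / σ_c} · [∫_{-1}^{1} e^{(nλ_c + i u √n/σ_c) r} (1-r²)^{(n-4)/2} dr] / [∫_{-1}^{1} e^{nλ_c r} (1-r²)^{(n-4)/2} dr]. Then for every integer K ≥ 1 and every η > 0 there exists N such that for all n ≥ N and all u ∈ ℝ, |Φ_n(u)| ≤ (1+η) · (2λ_c)^K / |λ_c + i u/(σ_c √n)|^K. -/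
open Real Filter

/-- `λ_c = c/(1-c²)`. -/
noncomputable def lamc (c : ℝ) : ℝ := c / (1 - c ^ 2)

/-- `σ_c = (1-c²)/√(1+c²)`. -/
noncomputable def sigc (c : ℝ) : ℝ := (1 - c ^ 2) / Real.sqrt (1 + c ^ 2)

/-- The characteristic function of `√n (rₙ - c)/σ_c` under the exponential change of
measure, in the spherical model. -/
noncomputable def PhiSpher (c : ℝ) (n : ℕ) (u : ℝ) : ℂ :=
  Complex.exp (-(Complex.I * u * c * Real.sqrt n / sigc c)) *
    (∫ r in (-1 : ℝ)..1,
        Complex.exp (((n : ℂ) * lamc c + Complex.I * u * Real.sqrt n / sigc c) * r) *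
          (((1 - r ^ 2) ^ (((n : ℝ) - 4) / 2) : ℝ) : ℂ)) /
    ((∫ r in (-1 : ℝ)..1,
        Real.exp ((n : ℝ) * lamc c * r) * (1 - r ^ 2) ^ (((n : ℝ) - 4) / 2) : ℝ) : ℂ)

open intervalIntegral in
/-- Integration by parts for `∫ e^{wr} r^a (1-r²)^b`; the boundary terms vanish. -/
lemma mul_integral_cexp_mul_rpow (w : ℂ) (a : ℕ) {b : ℝ} (hb : 1 ≤ b) :
    w * (∫ r in (-1 : ℝ)..1, Complex.exp (w * r) * ((r ^ a * (1 - r ^ 2) ^ b : ℝ) : ℂ)) =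
      2 * b * (∫ r in (-1 : ℝ)..1,
        Complex.exp (w * r) * ((r ^ (a + 1) * (1 - r ^ 2) ^ (b - 1) : ℝ) : ℂ)) -
      a * (∫ r in (-1 : ℝ)..1,
        Complex.exp (w * r) * ((r ^ (a - 1) * (1 - r ^ 2) ^ b : ℝ) : ℂ)) := by
  have hcont : ∀ (k : ℕ) (p : ℝ), 0 ≤ p → Continuous fun r : ℝ =>
      Complex.exp (w * r) * ((r ^ k * (1 - r ^ 2) ^ p : ℝ) : ℂ) := by
    intro k p hp
    have h1 : Continuous fun r : ℝ => (1 - r ^ 2) ^ p :=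
      (by fun_prop : Continuous fun r : ℝ => 1 - r ^ 2).rpow_const fun _ => Or.inr hp
    fun_prop
  have hderiv : ∀ r : ℝ, HasDerivAt
      (fun r : ℝ => Complex.exp (w * r) * ((r ^ a * (1 - r ^ 2) ^ b : ℝ) : ℂ))
      (w * (Complex.exp (w * r) * ((r ^ a * (1 - r ^ 2) ^ b : ℝ) : ℂ)) +
        a * (Complex.exp (w * r) * ((r ^ (a - 1) * (1 - r ^ 2) ^ b : ℝ) : ℂ)) -
        2 * b * (Complex.exp (w * r) *
          ((r ^ (a + 1) * (1 - r ^ 2) ^ (b - 1) : ℝ) : ℂ))) r := by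
    intro r
    have h1 : HasDerivAt (fun r : ℝ => Complex.exp (w * r)) (Complex.exp (w * r) * w) r := by
      simpa using ((Complex.ofRealCLM.hasDerivAt (x := r)).const_mul w).cexp
    have h2 : HasDerivAt (fun r : ℝ => (1 - r ^ 2) ^ b)
        (-(2 * r) * b * (1 - r ^ 2) ^ (b - 1)) r := by
      have h3 : HasDerivAt (fun r : ℝ => 1 - r ^ 2) (-(2 * r)) r := by
        simpa using (hasDerivAt_pow 2 r).const_sub 1
      exact h3.rpow_const (Or.inr hb)
    refine (h1.mul ((hasDerivAt_pow a r).mul h2).ofReal_comp).congr_deriv ?_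
    simp only [Pi.mul_apply]
    push_cast
    ring
  have hb0 : b ≠ 0 := by linarith
  have hint := integral_eq_sub_of_hasDerivAt (a := (-1 : ℝ)) (b := 1) (fun r _ => hderiv r)
    ((((hcont a b (by linarith)).const_mul w).add
      ((hcont (a - 1) b (by linarith)).const_mul a)).sub
      ((hcont (a + 1) (b - 1) (by linarith)).const_mul (2 * b)) |>.intervalIntegrable _ _)
  rw [integral_sub, integral_add, integral_const_mul, integral_const_mul,
    integral_const_mul] at hint
  · simp only [one_pow, even_two.neg_pow, sub_self, Real.zero_rpow hb0, mul_zero,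
      Complex.ofReal_zero] at hint
    linear_combination hint
  · exact ((hcont a b (by linarith)).const_mul w).intervalIntegrable _ _
  · exact ((hcont (a - 1) b (by linarith)).const_mul a).intervalIntegrable _ _
  · exact (((hcont a b (by linarith)).const_mul w).add
      ((hcont (a - 1) b (by linarith)).const_mul a)).intervalIntegrable _ _
  · exact ((hcont (a + 1) (b - 1) (by linarith)).const_mul (2 * b)).intervalIntegrable _ _

lemma continuous_exp_mul_rpow_mul_pow_add (l C : ℝ) (k : ℕ) {p : ℝ} (hp : 0 ≤ p) :
    Continuous fun r : ℝ => Real.exp (l * r) * (1 - r ^ 2) ^ p * (|r| ^ k + C) := by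
  have h1 : Continuous fun r : ℝ => (1 - r ^ 2) ^ p :=
    (by fun_prop : Continuous fun r : ℝ => 1 - r ^ 2).rpow_const fun _ => Or.inr hp
  fun_prop

/-- Iterated integration by parts, with the terms of lower order in `M` collected in `C / M`. -/
lemma exists_norm_pow_mul_integral_le (K : ℕ) : ∀ a : ℕ, ∃ C : ℝ, 0 ≤ C ∧
    ∀ (w : ℂ) (b M : ℝ), K ≤ b → 2 * b ≤ M → 1 ≤ M →
    ‖w‖ ^ K * ‖∫ r in (-1 : ℝ)..1, Complex.exp (w * r) * ((r ^ a * (1 - r ^ 2) ^ b : ℝ) : ℂ)‖ ≤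
      M ^ K * ∫ r in (-1 : ℝ)..1,
        Real.exp (w.re * r) * (1 - r ^ 2) ^ (b - K) * (|r| ^ (a + K) + C / M) := by
  induction K with
  | zero =>
    refine fun a => ⟨0, le_rfl, fun w b M hb _ _ => ?_⟩
    simp only [pow_zero, one_mul]
    refine (intervalIntegral.norm_integral_le_integral_norm (by norm_num)).trans_eq ?_
    refine intervalIntegral.integral_congr fun r hr => ?_
    rw [Set.uIcc_of_le (by norm_num)] at hr
    have h1 : 0 ≤ 1 - r ^ 2 := by nlinarith [hr.1, hr.2]
    simp only [norm_mul, Complex.norm_exp, Complex.norm_real, Real.norm_eq_abs, abs_pow,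
      abs_of_nonneg (Real.rpow_nonneg h1 b)]
    simp
    ring
  | succ K ih =>
    intro a
    obtain ⟨C₁, hC₁, h₁⟩ := ih (a + 1)
    obtain ⟨C₂, hC₂, h₂⟩ := ih (a - 1)
    refine ⟨C₁ + a * (1 + C₂), by positivity, fun w b M hb hM hM1 => ?_⟩
    simp only [Nat.cast_succ] at hb ⊢
    have hK : (0 : ℝ) ≤ K := K.cast_nonneg
    have h₁' := h₁ w (b - 1) M (by linarith) (by linarith) hM1
    have h₂' := h₂ w b M (by linarith) hM hM1
    have hparts := congrArg norm (mul_integral_cexp_mul_rpow w a (b := b) (by linarith))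
    rw [norm_mul] at hparts
    have htri := hparts.trans_le (norm_sub_le _ _)
    rw [norm_mul, norm_mul, norm_mul, Complex.norm_real, Complex.norm_natCast, Complex.norm_two,
      Real.norm_of_nonneg (by linarith : 0 ≤ b)] at htri
    have hM0 : 0 < M := by linarith
    rw [pow_succ, mul_assoc]
    refine (mul_le_mul_of_nonneg_left htri (by positivity)).trans ?_
    have hb' : b - 1 - K = b - (K + 1) := by ring
    rw [hb'] at h₁'
    set X := ‖∫ r in (-1 : ℝ)..1,
      Complex.exp (w * r) * ((r ^ (a + 1) * (1 - r ^ 2) ^ (b - 1) : ℝ) : ℂ)‖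
    set Y := ‖∫ r in (-1 : ℝ)..1,
      Complex.exp (w * r) * ((r ^ (a - 1) * (1 - r ^ 2) ^ b : ℝ) : ℂ)‖
    set p := b - (K + 1)
    have hp : 0 ≤ p := by simp only [p]; linarith
    have hc₁ := continuous_exp_mul_rpow_mul_pow_add w.re (C₁ / M) (a + 1 + K) hp
    have hc₂ := continuous_exp_mul_rpow_mul_pow_add w.re (C₂ / M) (a - 1 + K)
      (p := b - K) (by linarith)
    have hc := continuous_exp_mul_rpow_mul_pow_add w.re ((C₁ + a * (1 + C₂)) / M) (a + (K + 1)) hp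
    have hle : M * (∫ r in (-1 : ℝ)..1,
          Real.exp (w.re * r) * (1 - r ^ 2) ^ p * (|r| ^ (a + 1 + K) + C₁ / M)) +
        a * (∫ r in (-1 : ℝ)..1,
          Real.exp (w.re * r) * (1 - r ^ 2) ^ (b - K) * (|r| ^ (a - 1 + K) + C₂ / M)) ≤
        M * ∫ r in (-1 : ℝ)..1, Real.exp (w.re * r) * (1 - r ^ 2) ^ p *
          (|r| ^ (a + (K + 1)) + (C₁ + a * (1 + C₂)) / M) := by
      rw [← intervalIntegral.integral_const_mul, ← intervalIntegral.integral_const_mul,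
        ← intervalIntegral.integral_const_mul, ← intervalIntegral.integral_add
          ((hc₁.const_mul M).intervalIntegrable _ _) ((hc₂.const_mul _).intervalIntegrable _ _)]
      refine intervalIntegral.integral_mono_on (by norm_num)
        (((hc₁.const_mul M).add (hc₂.const_mul _)).intervalIntegrable _ _)
        ((hc.const_mul M).intervalIntegrable _ _) fun r hr => ?_
      have h0 : 0 ≤ 1 - r ^ 2 := by nlinarith [hr.1, hr.2]
      have hpow : (1 - r ^ 2) ^ (b - K) ≤ (1 - r ^ 2) ^ p := by
        have : b - K = p + 1 := by simp only [p]; ring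
        rw [this, Real.rpow_add_one' h0 (by linarith)]
        exact mul_le_of_le_one_right (Real.rpow_nonneg h0 _) (by nlinarith)
      have habs : |r| ^ (a - 1 + K) ≤ 1 := pow_le_one₀ (abs_nonneg r) (abs_le.2 hr)
      have hCM : C₂ / M ≤ C₂ := div_le_self hC₂ hM1
      have key : a * (Real.exp (w.re * r) * (1 - r ^ 2) ^ (b - K) *
          (|r| ^ (a - 1 + K) + C₂ / M)) ≤
          a * (Real.exp (w.re * r) * (1 - r ^ 2) ^ p * (1 + C₂)) := by
        have := Real.rpow_nonneg h0 p
        gcongr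
      refine (add_le_add_right key _).trans_eq ?_
      rw [show a + 1 + K = a + (K + 1) by ring]
      field_simp
      ring
    have hX : ‖w‖ ^ K * (2 * b * X) ≤ M ^ K * (M * ∫ r in (-1 : ℝ)..1,
        Real.exp (w.re * r) * (1 - r ^ 2) ^ p * (|r| ^ (a + 1 + K) + C₁ / M)) := by
      calc ‖w‖ ^ K * (2 * b * X) = (2 * b) * (‖w‖ ^ K * X) := by ring
        _ ≤ M * (‖w‖ ^ K * X) := by gcongr
        _ ≤ M * _ := mul_le_mul_of_nonneg_left h₁' hM0.le
        _ = _ := by ring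
    have hY := mul_le_mul_of_nonneg_left h₂' (Nat.cast_nonneg (α := ℝ) a)
    have := mul_le_mul_of_nonneg_left hle (pow_pos hM0 K).le
    rw [pow_succ, mul_assoc (M ^ K)]
    linarith

/-- The function `e^{λ_c r} √(1-r²)`, whose powers carry the exponential weight. -/
noncomputable def peak (c r : ℝ) : ℝ := Real.exp (lamc c * r) * √(1 - r ^ 2)

lemma continuous_peak (c : ℝ) : Continuous (peak c) := by
  unfold peak
  fun_prop

lemma peak_lt_peak {c r : ℝ} (hc : c ∈ Set.Ioo (0 : ℝ) 1) (hr : r ≠ c) :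
    peak c r < peak c c := by
  have hc2 : 0 < 1 - c ^ 2 := by nlinarith [hc.1, hc.2]
  have hsq : ∀ x : ℝ, peak c x = √(Real.exp (2 * (lamc c * x)) * (1 - x ^ 2)) := by
    intro x
    rw [Real.sqrt_mul (Real.exp_pos _).le, peak, two_mul, Real.exp_add,
      Real.sqrt_mul_self (Real.exp_pos _).le]
  rw [hsq, hsq]
  rw [Real.sqrt_lt_sqrt_iff_of_pos (by positivity)]
  have h1 : 1 - r ^ 2 ≤ (1 - c ^ 2) * Real.exp ((c ^ 2 - r ^ 2) / (1 - c ^ 2)) := by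
    have := Real.add_one_le_exp ((c ^ 2 - r ^ 2) / (1 - c ^ 2))
    refine le_trans (le_of_eq ?_) (mul_le_mul_of_nonneg_left this hc2.le)
    field_simp
    ring
  have h2 : 2 * (lamc c * r) + (c ^ 2 - r ^ 2) / (1 - c ^ 2) < 2 * (lamc c * c) := by
    have : 2 * (lamc c * r) + (c ^ 2 - r ^ 2) / (1 - c ^ 2) =
        2 * (lamc c * c) - (r - c) ^ 2 / (1 - c ^ 2) := by
      unfold lamc
      field_simp
      ring
    have h3 : 0 < (r - c) ^ 2 / (1 - c ^ 2) := by
      have := sub_ne_zero.2 hr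
      positivity
    linarith
  calc Real.exp (2 * (lamc c * r)) * (1 - r ^ 2)
      ≤ Real.exp (2 * (lamc c * r)) *
        ((1 - c ^ 2) * Real.exp ((c ^ 2 - r ^ 2) / (1 - c ^ 2))) := by gcongr
    _ = Real.exp (2 * (lamc c * r) + (c ^ 2 - r ^ 2) / (1 - c ^ 2)) * (1 - c ^ 2) := by
      rw [Real.exp_add]
      ring
    _ < _ := by gcongr

lemma exp_mul_rpow_eq_peak_pow {c r : ℝ} (hr : r ∈ Set.Icc (-1 : ℝ) 1) (N j : ℕ) :
    Real.exp (((N + j : ℕ) : ℝ) * lamc c * r) * (1 - r ^ 2) ^ ((N : ℝ) / 2) =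
      peak c r ^ N * Real.exp (j * lamc c * r) := by
  have h0 : 0 ≤ 1 - r ^ 2 := by nlinarith [hr.1, hr.2]
  rw [peak, mul_pow, ← Real.exp_nat_mul, Real.rpow_div_two_eq_sqrt _ h0, Real.rpow_natCast,
    mul_right_comm _ _ (Real.exp (j * lamc c * r)), ← Real.exp_add]
  congr 2
  push_cast
  ring

/-- Laplace's method for the powers of `peak c`. -/
lemma tendsto_integral_peak_pow_mul {c : ℝ} (hc : c ∈ Set.Ioo (0 : ℝ) 1) {g : ℝ → ℝ}
    (hg : Continuous g) :
    Tendsto (fun N : ℕ => (∫ r in (-1 : ℝ)..1, peak c r ^ N)⁻¹ *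
      ∫ r in (-1 : ℝ)..1, peak c r ^ N * g r) atTop (nhds (g c)) := by
  have hmem : c ∈ Set.Ioo (-1 : ℝ) 1 := ⟨by linarith [hc.1], hc.2⟩
  have hpos : 0 < peak c c := by
    have : 0 < 1 - c ^ 2 := by nlinarith [hc.1, hc.2]
    unfold peak
    positivity
  have := tendsto_setIntegral_pow_smul_of_unique_maximum_of_isCompact_of_continuousOn
    (μ := MeasureTheory.volume) (isCompact_Icc (a := (-1 : ℝ)) (b := 1))
    (continuous_peak c).continuousOn (fun y _ hy => peak_lt_peak hc hy)
    (fun x _ => mul_nonneg (Real.exp_pos _).le (Real.sqrt_nonneg _)) hpos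
    (by rw [interior_Icc]; exact subset_closure hmem) hg.continuousOn
  simpa only [smul_eq_mul, intervalIntegral.integral_of_le (by norm_num : (-1 : ℝ) ≤ 1),
    MeasureTheory.integral_Icc_eq_integral_Ioc] using this

/-- The ratio bounding the characteristic function tends to `λ_c^K`. -/
lemma tendsto_weight_ratio {c : ℝ} (hc : c ∈ Set.Ioo (0 : ℝ) 1) (K j : ℕ) (C : ℝ) :
    Tendsto (fun N : ℕ =>
      (∫ r in (-1 : ℝ)..1, peak c r ^ N * (Real.exp (j * lamc c * r) *
        (|r| ^ K + C / ((N + j : ℕ) : ℝ)))) /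
      ∫ r in (-1 : ℝ)..1, peak c r ^ N * (Real.exp (j * lamc c * r) * (1 - r ^ 2) ^ K))
      atTop (nhds (lamc c ^ K)) := by
  have hc2 : 0 < 1 - c ^ 2 := by nlinarith [hc.1, hc.2]
  have hp := continuous_peak c
  have t1 := tendsto_integral_peak_pow_mul hc
    (g := fun r => Real.exp (j * lamc c * r) * |r| ^ K) (by fun_prop)
  have t2 := tendsto_integral_peak_pow_mul hc
    (g := fun r => Real.exp (j * lamc c * r)) (by fun_prop)
  have t3 := tendsto_integral_peak_pow_mul hc
    (g := fun r => Real.exp (j * lamc c * r) * (1 - r ^ 2) ^ K) (by fun_prop)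
  have t4 : Tendsto (fun N : ℕ => C / ((N + j : ℕ) : ℝ)) atTop (nhds 0) :=
    (tendsto_const_div_atTop_nhds_zero_nat C).comp (tendsto_add_atTop_nat j)
  have t := (t1.add (t4.mul t2)).div t3 (by positivity)
  have hlim : (Real.exp (j * lamc c * c) * |c| ^ K + 0 * Real.exp (j * lamc c * c)) /
      (Real.exp (j * lamc c * c) * (1 - c ^ 2) ^ K) = lamc c ^ K := by
    rw [abs_of_pos hc.1, lamc, div_pow]
    field_simp
    ring
  rw [hlim] at t
  refine t.congr fun N => ?_
  have hI : 0 < ∫ r in (-1 : ℝ)..1, peak c r ^ N := by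
    refine intervalIntegral.intervalIntegral_pos_of_pos_on
      ((hp.pow N).intervalIntegrable _ _) (fun r hr => ?_) (by norm_num)
    have : 0 < 1 - r ^ 2 := by nlinarith [hr.1, hr.2]
    unfold peak
    positivity
  have hsplit : (∫ r in (-1 : ℝ)..1, peak c r ^ N * (Real.exp (j * lamc c * r) *
        (|r| ^ K + C / ((N + j : ℕ) : ℝ)))) =
      (∫ r in (-1 : ℝ)..1, peak c r ^ N * (Real.exp (j * lamc c * r) * |r| ^ K)) +
      C / ((N + j : ℕ) : ℝ) * ∫ r in (-1 : ℝ)..1, peak c r ^ N * Real.exp (j * lamc c * r) := by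
    rw [← intervalIntegral.integral_const_mul, ← intervalIntegral.integral_add]
    · congr 1 with r
      ring
    · exact Continuous.intervalIntegrable (by fun_prop) _ _
    · exact Continuous.intervalIntegrable (by fun_prop) _ _
  rw [hsplit]
  simp only [Pi.div_apply]
  rw [mul_left_comm, ← mul_add, mul_div_mul_left _ _ (inv_ne_zero hI.ne')]

theorem stmt_5 (c : ℝ) (hc : c ∈ Set.Ioo (0 : ℝ) 1) (K : ℕ) (hK : 1 ≤ K)
    (η : ℝ) (hη : 0 < η) :
    ∃ N : ℕ, ∀ n : ℕ, N ≤ n → ∀ u : ℝ,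
      ‖PhiSpher c n u‖ ≤
        (1 + η) * (2 * lamc c) ^ K /
          ‖(lamc c : ℂ) + Complex.I * u / (sigc c * Real.sqrt n)‖ ^ K := by
  have hc2 : 0 < 1 - c ^ 2 := by nlinarith [hc.1, hc.2]
  have hl : 0 < lamc c := div_pos hc.1 hc2
  obtain ⟨C, hC, hbound⟩ := exists_norm_pow_mul_integral_le K 0
  have hlt : lamc c ^ K < (1 + η) * (2 * lamc c) ^ K := by
    have h1 : lamc c ^ K ≤ (2 * lamc c) ^ K := by gcongr; linarith
    have h2 : 0 < (2 * lamc c) ^ K := by positivity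
    nlinarith
  obtain ⟨N₀, hN₀⟩ := eventually_atTop.1
    ((tendsto_weight_ratio hc K (2 * K + 4) C).eventually_lt_const hlt)
  refine ⟨N₀ + (2 * K + 4), fun n hn u => ?_⟩
  obtain ⟨N, rfl⟩ := Nat.exists_eq_add_of_le' (le_of_add_le_right hn)
  have hratio := hN₀ N (by omega)
  set n := N + (2 * K + 4) with hn_def
  have hn0 : (0 : ℝ) < n := by positivity
  have hncast : (n : ℝ) = N + 2 * K + 4 := by rw [hn_def]; push_cast; ring
  set z : ℂ := (lamc c : ℂ) + Complex.I * u / (sigc c * Real.sqrt n) with hz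
  set w : ℂ := (n : ℂ) * lamc c + Complex.I * u * Real.sqrt n / sigc c with hw
  have hs : sigc c ≠ 0 := by unfold sigc; positivity
  have hwz : w = n * z := by
    have h1 : (Real.sqrt n : ℂ) ≠ 0 := by
      exact_mod_cast (Real.sqrt_pos.2 hn0).ne'
    have h2 : (Real.sqrt n : ℂ) ^ 2 = n := by exact_mod_cast Real.sq_sqrt hn0.le
    have h3 : (sigc c : ℂ) ≠ 0 := by exact_mod_cast hs
    rw [hw, hz, ← h2]
    field_simp
  have hre : ∀ x y : ℝ, (Complex.I * x * y / sigc c).re = 0 := by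
    intro x y
    rw [show Complex.I * x * y / sigc c = ((x * y / sigc c : ℝ) : ℂ) * Complex.I by
      push_cast; ring]
    simp
  have hwre : w.re = n * lamc c := by
    rw [hw, Complex.add_re, hre, ← Complex.ofReal_natCast, ← Complex.ofReal_mul, Complex.ofReal_re,
      add_zero]
  have hz_ne : z ≠ 0 := by
    intro h
    rw [hwz, h, mul_zero, Complex.zero_re] at hwre
    exact (mul_pos hn0 hl).ne hwre
  have hz0 : 0 < ‖z‖ ^ K := by positivity
  have hmain := hbound w ((n - 4) / 2) n (by linarith [N.cast_nonneg (α := ℝ)]) (by linarith)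
    (by linarith [N.cast_nonneg (α := ℝ), K.cast_nonneg (α := ℝ)])
  rw [hwz, norm_mul, Complex.norm_natCast, mul_pow, mul_assoc,
    mul_le_mul_iff_right₀ (by positivity), ← hwz, hwre] at hmain
  have hnum : (∫ r in (-1 : ℝ)..1, Real.exp (n * lamc c * r) *
      (1 - r ^ 2) ^ (((n : ℝ) - 4) / 2 - K) * (|r| ^ (0 + K) + C / n)) =
      ∫ r in (-1 : ℝ)..1, peak c r ^ N * (Real.exp ((2 * K + 4 : ℕ) * lamc c * r) *
        (|r| ^ K + C / n)) := by
    refine intervalIntegral.integral_congr fun r hr => ?_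
    rw [Set.uIcc_of_le (by norm_num)] at hr
    have := exp_mul_rpow_eq_peak_pow (c := c) hr N (2 * K + 4)
    simp only [zero_add]
    rw [← mul_assoc, ← this, show ((n : ℝ) - 4) / 2 - K = N / 2 by rw [hncast]; ring]
  have hden : (∫ r in (-1 : ℝ)..1, Real.exp (n * lamc c * r) *
      (1 - r ^ 2) ^ (((n : ℝ) - 4) / 2)) =
      ∫ r in (-1 : ℝ)..1, peak c r ^ N * (Real.exp ((2 * K + 4 : ℕ) * lamc c * r) *
        (1 - r ^ 2) ^ K) := by
    refine intervalIntegral.integral_congr fun r hr => ?_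
    rw [Set.uIcc_of_le (by norm_num)] at hr
    have h0 : 0 ≤ 1 - r ^ 2 := by nlinarith [hr.1, hr.2]
    have := exp_mul_rpow_eq_peak_pow (c := c) hr N (2 * K + 4)
    rw [← mul_assoc, ← this, show ((n : ℝ) - 4) / 2 = N / 2 + K by rw [hncast]; ring,
      Real.rpow_add_of_nonneg h0 (by positivity) (by positivity), Real.rpow_natCast, ← mul_assoc]
  have hden0 : 0 ≤ ∫ r in (-1 : ℝ)..1, Real.exp (n * lamc c * r) *
      (1 - r ^ 2) ^ (((n : ℝ) - 4) / 2) := by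
    refine intervalIntegral.integral_nonneg (by norm_num) fun r hr => ?_
    have h0 : 0 ≤ 1 - r ^ 2 := by nlinarith [hr.1, hr.2]
    positivity
  rw [PhiSpher, norm_div, norm_mul, Complex.norm_exp, Complex.neg_re, ← hw, Complex.norm_real,
    Real.norm_of_nonneg hden0]
  rw [show (Complex.I * u * c * Real.sqrt n / sigc c).re = 0 by
    simp [mul_assoc], neg_zero, Real.exp_zero, one_mul,
    le_div_iff₀ hz0, div_mul_eq_mul_div, mul_comm]
  simp only [pow_zero, one_mul] at hmain
  refine (div_le_div_of_nonneg_right hmain hden0).trans ?_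
  rw [hnum, hden]
  exact hratio.le
end

section
/- Fix c ∈ (0,1), λ_c = c/(1-c²) and σ_c = (1-c²)/√(1+c²), and for n > 4 define Φ_n(u) = e^{-i u c √n / σ_c} · [∫_{-1}^{1} e^{(nλ_c + i u √n/σ_c) r} (1-r²)^{(n-4)/2} dr] / [∫_{-1}^{1} e^{nλ_c r} (1-r²)^{(n-4)/2} dr]. Then (i) for every u ∈ ℝ, Φ_n(u) → e^{-u²/2} as n → ∞, and (ii) C_n := (2π)^{-1/2} ∫_ℝ (1 + i u/(λ_c σ_c √n))^{-1} Φ_n(u) du → 1 as n → ∞. -/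
open Real Filter

/-- The weight `e^{N(r-c)} (1-r²)^e`, normalized to take the value `1` at `r = c`. -/
noncomputable def tiltedWeight (c N e r : ℝ) : ℝ :=
  Real.exp (N * (r - c)) * ((1 - r ^ 2) / (1 - c ^ 2)) ^ e

/-- The Fourier integral over `[-1, 1]` of `tiltedWeight`, centred at `c`. -/
noncomputable def tiltedFourier (c N e s : ℝ) : ℂ :=
  ∫ r in (-1 : ℝ)..1, Complex.exp (Complex.I * (s * (r - c) : ℝ)) * (tiltedWeight c N e r : ℂ)

lemma norm_cexp_I_mul_ofReal (x : ℝ) : ‖Complex.exp (Complex.I * (x : ℂ))‖ = 1 := by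
  rw [mul_comm, Complex.norm_exp_ofReal_mul_I]

lemma tiltedWeight_nonneg {c : ℝ} (hc : c ∈ Set.Ioo (0 : ℝ) 1) (N e : ℝ) {r : ℝ}
    (hr : r ∈ Set.Icc (-1 : ℝ) 1) : 0 ≤ tiltedWeight c N e r := by
  have h1 : 0 ≤ 1 - r ^ 2 := by nlinarith [hr.1, hr.2]
  have h2 : 0 ≤ 1 - c ^ 2 := by nlinarith [hc.1, hc.2]
  unfold tiltedWeight
  positivity

lemma continuous_tiltedWeight (c N : ℝ) {e : ℝ} (he : 0 ≤ e) :
    Continuous (tiltedWeight c N e) := by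
  unfold tiltedWeight
  exact (by fun_prop : Continuous fun r : ℝ => Real.exp (N * (r - c))).mul
    ((by fun_prop : Continuous fun r : ℝ => (1 - r ^ 2) / (1 - c ^ 2)).rpow_const
      fun _ => Or.inr he)

lemma hasDerivAt_tiltedWeight (c N : ℝ) {e : ℝ} (he : 1 ≤ e) (r : ℝ) :
    HasDerivAt (tiltedWeight c N e)
      (N * tiltedWeight c N e r - 2 * e / (1 - c ^ 2) * r * tiltedWeight c N (e - 1) r) r := by
  have h1 : HasDerivAt (fun r : ℝ => Real.exp (N * (r - c))) (Real.exp (N * (r - c)) * N) r := by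
    simpa using (((hasDerivAt_id r).sub_const c).const_mul N).exp
  have h2 : HasDerivAt (fun r : ℝ => (1 - r ^ 2) / (1 - c ^ 2)) (-(2 * r) / (1 - c ^ 2)) r := by
    simpa using ((hasDerivAt_pow 2 r).const_sub 1).div_const (1 - c ^ 2)
  refine (h1.mul (h2.rpow_const (Or.inr he))).congr_deriv ?_
  unfold tiltedWeight
  ring

/-- If `g'' = P - Q` with `P, Q ≥ 0` and `g`, `g'` vanish at the endpoints, then two integrations by
parts bound the Fourier integral of `g` by `∫ Q`. -/
lemma sq_mul_norm_fourier_le {g g' P Q : ℝ → ℝ} {a b : ℝ} (hab : a ≤ b) (c s : ℝ)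
    (hg : ∀ x, HasDerivAt g (g' x) x) (hg' : ∀ x, HasDerivAt g' (P x - Q x) x)
    (hPc : Continuous P) (hQc : Continuous Q)
    (hP : ∀ x ∈ Set.Icc a b, 0 ≤ P x) (hQ : ∀ x ∈ Set.Icc a b, 0 ≤ Q x)
    (ha : g a = 0) (hb : g b = 0) (ha' : g' a = 0) (hb' : g' b = 0) :
    s ^ 2 * ‖∫ x in a..b, Complex.exp (Complex.I * (s * (x - c) : ℝ)) * (g x : ℂ)‖ ≤
      2 * ∫ x in a..b, Q x := by
  have hgc : Continuous g := continuous_iff_continuousAt.2 fun x => (hg x).continuousAt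
  have hPQ : ∫ x in a..b, P x = ∫ x in a..b, Q x := by
    have h := intervalIntegral.integral_eq_sub_of_hasDerivAt (a := a) (b := b) (fun x _ => hg' x)
      ((hPc.sub hQc).intervalIntegrable _ _)
    rw [ha', hb', intervalIntegral.integral_sub (hPc.intervalIntegrable _ _)
      (hQc.intervalIntegrable _ _)] at h
    linarith
  have he : ∀ x : ℝ, HasDerivAt (fun x : ℝ => Complex.exp (Complex.I * (s * (x - c) : ℝ)))
      (Complex.exp (Complex.I * (s * (x - c) : ℝ)) * (Complex.I * s)) x := by
    intro x
    have h1 : HasDerivAt (fun x : ℝ => s * (x - c)) s x := by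
      simpa using ((hasDerivAt_id x).sub_const c).const_mul s
    exact ((h1.ofReal_comp).const_mul Complex.I).cexp
  have hprim : ∀ x : ℝ, HasDerivAt
      (fun x : ℝ => Complex.exp (Complex.I * (s * (x - c) : ℝ)) * (g' x - Complex.I * s * g x))
      (Complex.exp (Complex.I * (s * (x - c) : ℝ)) * ((P x - Q x : ℝ) : ℂ) +
        (s ^ 2 : ℂ) * (Complex.exp (Complex.I * (s * (x - c) : ℝ)) * (g x : ℂ))) x := by
    intro x
    refine ((he x).mul ((hg' x).ofReal_comp.sub
      ((hg x).ofReal_comp.const_mul (Complex.I * s)))).congr_deriv ?_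
    simp only [Pi.sub_apply]
    linear_combination (-(s : ℂ) ^ 2 * g x *
      Complex.exp (Complex.I * (s * (x - c) : ℝ))) * Complex.I_sq
  have hc1 : Continuous fun x : ℝ =>
      Complex.exp (Complex.I * (s * (x - c) : ℝ)) * ((P x - Q x : ℝ) : ℂ) := by fun_prop
  have hc2 : Continuous fun x : ℝ =>
      (s ^ 2 : ℂ) * (Complex.exp (Complex.I * (s * (x - c) : ℝ)) * (g x : ℂ)) := by fun_prop
  have hsum := intervalIntegral.integral_eq_sub_of_hasDerivAt (a := a) (b := b)
    (fun x _ => hprim x) ((hc1.add hc2).intervalIntegrable _ _)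
  rw [intervalIntegral.integral_add (hc1.intervalIntegrable _ _) (hc2.intervalIntegrable _ _),
    ha, hb, ha', hb', intervalIntegral.integral_const_mul, Complex.ofReal_zero] at hsum
  have hsum' : (s ^ 2 : ℂ) * ∫ x in a..b, Complex.exp (Complex.I * (s * (x - c) : ℝ)) * (g x : ℂ)
      = -∫ x in a..b, Complex.exp (Complex.I * (s * (x - c) : ℝ)) * ((P x - Q x : ℝ) : ℂ) := by
    linear_combination hsum
  have hnorm := congrArg norm hsum'
  rw [norm_mul, norm_neg, norm_pow, Complex.norm_real, Real.norm_eq_abs, sq_abs] at hnorm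
  rw [hnorm]
  refine (intervalIntegral.norm_integral_le_integral_norm hab).trans ?_
  calc ∫ x in a..b, ‖Complex.exp (Complex.I * (s * (x - c) : ℝ)) * ((P x - Q x : ℝ) : ℂ)‖
      ≤ ∫ x in a..b, (P x + Q x) := by
        refine intervalIntegral.integral_mono_on hab (hc1.norm.intervalIntegrable _ _)
          ((hPc.add hQc).intervalIntegrable _ _) fun x hx => ?_
        rw [norm_mul, norm_cexp_I_mul_ofReal, one_mul, Complex.norm_real, Real.norm_eq_abs]
        exact abs_le.2 ⟨by linarith [hP x hx], by linarith [hQ x hx]⟩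
    _ = 2 * ∫ x in a..b, Q x := by
        rw [intervalIntegral.integral_add (hPc.intervalIntegrable _ _)
          (hQc.intervalIntegrable _ _), hPQ]
        ring

lemma tiltedFourier_zero (c N e : ℝ) :
    tiltedFourier c N e 0 = ((∫ r in (-1 : ℝ)..1, tiltedWeight c N e r : ℝ) : ℂ) := by
  simp [tiltedFourier, intervalIntegral.integral_ofReal]

lemma norm_tiltedFourier_zero {c : ℝ} (hc : c ∈ Set.Ioo (0 : ℝ) 1) (N e : ℝ) :
    ‖tiltedFourier c N e 0‖ = ∫ r in (-1 : ℝ)..1, tiltedWeight c N e r := by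
  rw [tiltedFourier_zero, Complex.norm_real, Real.norm_of_nonneg]
  exact intervalIntegral.integral_nonneg (by norm_num) fun r hr => tiltedWeight_nonneg hc N e hr

lemma norm_tiltedFourier_le {c : ℝ} (hc : c ∈ Set.Ioo (0 : ℝ) 1) (N s e : ℝ) :
    ‖tiltedFourier c N e s‖ ≤ ‖tiltedFourier c N e 0‖ := by
  rw [norm_tiltedFourier_zero hc]
  refine (intervalIntegral.norm_integral_le_integral_norm (by norm_num)).trans_eq ?_
  refine intervalIntegral.integral_congr fun r hr => ?_
  rw [Set.uIcc_of_le (by norm_num)] at hr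
  simp only [norm_mul, norm_cexp_I_mul_ofReal, one_mul, Complex.norm_real]
  exact Real.norm_of_nonneg (tiltedWeight_nonneg hc N e hr)

lemma tiltedWeight_eq_mul_sub_one {c : ℝ} (hc : c ∈ Set.Ioo (0 : ℝ) 1) (N : ℝ) {e : ℝ}
    (he : 1 < e) (r : ℝ) :
    tiltedWeight c N e r = (1 - r ^ 2) / (1 - c ^ 2) * tiltedWeight c N (e - 1) r := by
  unfold tiltedWeight
  have h2 : 1 - c ^ 2 ≠ 0 := by nlinarith [hc.1, hc.2]
  rcases eq_or_ne ((1 - r ^ 2) / (1 - c ^ 2)) 0 with h | h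
  · rw [h, Real.zero_rpow (by linarith)]
    simp
  · rw [Real.rpow_sub_one h, mul_left_comm, mul_div_cancel₀ _ h]

lemma sq_mul_norm_tiltedFourier_le {c : ℝ} (hc : c ∈ Set.Ioo (0 : ℝ) 1) (N s : ℝ) {e : ℝ}
    (he : 3 < e) :
    s ^ 2 * ‖tiltedFourier c N e s‖ ≤
      8 * e / (1 - c ^ 2) ^ 2 * ‖tiltedFourier c N (e - 2) 0‖ := by
  have h2 : 0 < 1 - c ^ 2 := by nlinarith [hc.1, hc.2]
  set w := tiltedWeight c N (e - 2) with hw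
  have hwc : Continuous w := continuous_tiltedWeight c N (by linarith)
  have e1 : ∀ r, tiltedWeight c N (e - 1) r = (1 - r ^ 2) / (1 - c ^ 2) * w r := fun r => by
    rw [tiltedWeight_eq_mul_sub_one hc N (by linarith), hw]
    ring_nf
  have e0 : ∀ r, tiltedWeight c N e r = ((1 - r ^ 2) / (1 - c ^ 2)) ^ 2 * w r := fun r => by
    rw [tiltedWeight_eq_mul_sub_one hc N (by linarith), e1]
    ring
  have hd : ∀ r, HasDerivAt (fun r => N * tiltedWeight c N e r -
        2 * e / (1 - c ^ 2) * r * tiltedWeight c N (e - 1) r)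
      ((N * ((1 - r ^ 2) / (1 - c ^ 2)) - 2 * e / (1 - c ^ 2) * r) ^ 2 * w r -
        2 * e / (1 - c ^ 2) ^ 2 * (1 + r ^ 2) * w r) r := by
    intro r
    have h3 : HasDerivAt (fun r : ℝ => 2 * e / (1 - c ^ 2) * r) (2 * e / (1 - c ^ 2)) r := by
      simpa using (hasDerivAt_id r).const_mul (2 * e / (1 - c ^ 2))
    refine (((hasDerivAt_tiltedWeight c N (by linarith) r).const_mul N).sub
      (h3.mul (hasDerivAt_tiltedWeight c N (e := e - 1) (by linarith) r))).congr_deriv ?_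
    rw [show e - 1 - 1 = e - 2 by ring, ← hw, e0, e1]
    field_simp
    ring
  have key := sq_mul_norm_fourier_le (a := -1) (b := 1) (by norm_num) c s
    (hasDerivAt_tiltedWeight c N (by linarith)) hd (by fun_prop) (by fun_prop)
    (fun r hr => mul_nonneg (sq_nonneg _) (tiltedWeight_nonneg hc _ _ hr))
    (fun r hr => mul_nonneg (by positivity) (tiltedWeight_nonneg hc _ _ hr))
    (by simp [e0]) (by simp [e0]) (by simp [e0, e1]) (by simp [e0, e1])
  refine key.trans ?_
  rw [norm_tiltedFourier_zero hc, ← hw, ← intervalIntegral.integral_const_mul,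
    ← intervalIntegral.integral_const_mul]
  refine intervalIntegral.integral_mono_on (by norm_num)
    (Continuous.intervalIntegrable (by fun_prop) _ _)
    (Continuous.intervalIntegrable (by fun_prop) _ _) fun r hr => ?_
  have hw0 : 0 ≤ w r := tiltedWeight_nonneg hc _ _ hr
  have hr2 : r ^ 2 ≤ 1 := by nlinarith [hr.1, hr.2]
  have : 0 ≤ 4 * e / (1 - c ^ 2) ^ 2 * w r * (1 - r ^ 2) :=
    mul_nonneg (by positivity) (by linarith)
  linear_combination this

lemma one_sub_sq_pos {c : ℝ} (hc : c ∈ Set.Ioo (0 : ℝ) 1) : 0 < 1 - c ^ 2 := by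
  nlinarith [hc.1, hc.2]

lemma sigc_pos {c : ℝ} (hc : c ∈ Set.Ioo (0 : ℝ) 1) : 0 < sigc c :=
  div_pos (one_sub_sq_pos hc) (by positivity)

lemma sigc_sq {c : ℝ} : sigc c ^ 2 = (1 - c ^ 2) ^ 2 / (1 + c ^ 2) := by
  rw [sigc, div_pow, Real.sq_sqrt (by positivity)]

lemma lamc_pos {c : ℝ} (hc : c ∈ Set.Ioo (0 : ℝ) 1) : 0 < lamc c :=
  div_pos hc.1 (one_sub_sq_pos hc)

lemma ratio_eq {c : ℝ} (hc : c ∈ Set.Ioo (0 : ℝ) 1) (y : ℝ) :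
    (1 - (c + y) ^ 2) / (1 - c ^ 2) = 1 - (2 * lamc c * y + y ^ 2 / (1 - c ^ 2)) := by
  have := (one_sub_sq_pos hc).ne'
  unfold lamc
  field_simp
  ring

lemma tendsto_inv_sqrt_natCast : Tendsto (fun n : ℕ => (√(n : ℝ))⁻¹) atTop (nhds 0) :=
  tendsto_inv_atTop_zero.comp (Real.tendsto_sqrt_atTop.comp tendsto_natCast_atTop_atTop)

/-- Second-order expansion of the logarithm along a sequence of order `1/√n`. -/
lemma tendsto_mul_log_one_sub_add {t : ℕ → ℝ} (ht : Tendsto t atTop (nhds 0)) {L : ℝ}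
    (hL : Tendsto (fun n : ℕ => (n : ℝ) * t n ^ 2) atTop (nhds L)) :
    Tendsto (fun n : ℕ => (n : ℝ) * (Real.log (1 - t n) + t n)) atTop (nhds (-L / 2)) := by
  have habs : Tendsto (fun n => |t n|) atTop (nhds 0) := by simpa using ht.abs
  have hrem : Tendsto (fun n : ℕ => (n : ℝ) * (t n + t n ^ 2 / 2 + Real.log (1 - t n)))
      atTop (nhds 0) := by
    have hb : Tendsto (fun n : ℕ => (n : ℝ) * t n ^ 2 * (|t n| / (1 - |t n|))) atTop (nhds 0) := by
      simpa using hL.mul (habs.div (habs.const_sub 1) (by norm_num))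
    refine squeeze_zero_norm' ?_ hb
    filter_upwards [habs.eventually (gt_mem_nhds one_pos)] with n hn
    have h := Real.abs_log_sub_add_sum_range_le hn 2
    norm_num [Finset.sum_range_succ] at h
    rw [norm_mul, Real.norm_natCast, Real.norm_eq_abs, mul_assoc]
    refine mul_le_mul_of_nonneg_left (h.trans_eq ?_) n.cast_nonneg
    rw [← sq_abs (t n)]
    ring
  have := hrem.sub (hL.div_const 2)
  convert this using 2
  · ring
  · ring

lemma tendsto_tiltedWeight {c : ℝ} (hc : c ∈ Set.Ioo (0 : ℝ) 1) (p x : ℝ) :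
    Tendsto (fun n : ℕ => tiltedWeight c (n * lamc c) (n / 2 - p) (c + x / √n)) atTop
      (nhds (Real.exp (-(1 / (2 * sigc c ^ 2)) * x ^ 2))) := by
  have h2 := one_sub_sq_pos hc
  set t : ℕ → ℝ := fun n => 2 * lamc c * (x / √n) + (x / √n) ^ 2 / (1 - c ^ 2) with ht_def
  have hy : Tendsto (fun n : ℕ => x / √(n : ℝ)) atTop (nhds 0) := by
    simpa [div_eq_mul_inv] using tendsto_inv_sqrt_natCast.const_mul x
  have ht : Tendsto t atTop (nhds 0) := by
    simpa using (hy.const_mul (2 * lamc c)).add ((hy.pow 2).div_const (1 - c ^ 2))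
  have hL : Tendsto (fun n : ℕ => (n : ℝ) * t n ^ 2) atTop (nhds ((2 * lamc c * x) ^ 2)) := by
    have h : Tendsto (fun n : ℕ => (2 * lamc c * x + x * (x / √n) / (1 - c ^ 2)) ^ 2) atTop
        (nhds ((2 * lamc c * x) ^ 2)) := by
      simpa using (((hy.const_mul x).div_const (1 - c ^ 2)).const_add (2 * lamc c * x)).pow 2
    refine h.congr' ?_
    filter_upwards [eventually_gt_atTop 0] with n hn
    have hn' : 0 < √(n : ℝ) := Real.sqrt_pos.2 (Nat.cast_pos.2 hn)
    have hsq : (n : ℝ) = √(n : ℝ) ^ 2 := (Real.sq_sqrt n.cast_nonneg).symm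
    simp only [ht_def]
    rw [hsq, Real.sqrt_sq hn'.le]
    field_simp
  have hlog0 : Tendsto (fun n => Real.log (1 - t n)) atTop (nhds 0) := by
    have := (ht.const_sub 1).log (by norm_num)
    simpa using this
  have hexp : Tendsto (fun n : ℕ => ((n : ℝ) * (Real.log (1 - t n) + t n)) / 2 -
      p * Real.log (1 - t n) - x ^ 2 / (2 * (1 - c ^ 2))) atTop
      (nhds (-(1 / (2 * sigc c ^ 2)) * x ^ 2)) := by
    have := (((tendsto_mul_log_one_sub_add ht hL).div_const 2).sub (hlog0.const_mul p)).sub_const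
      (x ^ 2 / (2 * (1 - c ^ 2)))
    convert this using 2
    rw [sigc_sq, lamc]
    field_simp
    ring
  refine ((Real.continuous_exp.tendsto _).comp hexp).congr' ?_
  filter_upwards [eventually_gt_atTop 0, ht.eventually (gt_mem_nhds one_pos)] with n hn htn
  have hn' : 0 < √(n : ℝ) := Real.sqrt_pos.2 (Nat.cast_pos.2 hn)
  have hsq : (n : ℝ) = √(n : ℝ) ^ 2 := (Real.sq_sqrt n.cast_nonneg).symm
  rw [tiltedWeight, ratio_eq hc, Real.rpow_def_of_pos (by linarith [htn]), ← Real.exp_add,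
    Function.comp_apply]
  congr 1
  change _ = _ + Real.log (1 - t n) * _
  have hnt : (n : ℝ) * t n = 2 * (n * lamc c * (x / √n)) + x ^ 2 / (1 - c ^ 2) := by
    simp only [ht_def]
    rw [hsq, Real.sqrt_sq hn'.le]
    field_simp
  have : x ^ 2 / (2 * (1 - c ^ 2)) = x ^ 2 / (1 - c ^ 2) / 2 := by field_simp
  rw [this]
  linear_combination hnt / 2

lemma tiltedWeight_le {c : ℝ} (hc : c ∈ Set.Ioo (0 : ℝ) 1) {p : ℝ} (hp : 0 ≤ p) {n : ℕ}
    (hn : 0 < n) (hnp : 4 * p ≤ n) {x : ℝ} (hx : c + x / √n ∈ Set.Icc (-1 : ℝ) 1) :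
    tiltedWeight c (n * lamc c) (n / 2 - p) (c + x / √n) ≤
      Real.exp (4 * p * lamc c) * Real.exp (-(1 / 4) * x ^ 2) := by
  have h2 := one_sub_sq_pos hc
  have hl := lamc_pos hc
  set y := x / √(n : ℝ) with hy
  have hn' : 0 < √(n : ℝ) := Real.sqrt_pos.2 (Nat.cast_pos.2 hn)
  have hxy : x ^ 2 = n * y ^ 2 := by
    rw [hy, div_pow, Real.sq_sqrt n.cast_nonneg]
    field_simp
  have hq0 : 0 ≤ (1 - (c + y) ^ 2) / (1 - c ^ 2) :=
    div_nonneg (by nlinarith [hx.1, hx.2]) h2.le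
  have hq : (1 - (c + y) ^ 2) / (1 - c ^ 2) ≤ Real.exp (-(2 * lamc c * y + y ^ 2)) := by
    rw [ratio_eq hc]
    have h3 : y ^ 2 ≤ y ^ 2 / (1 - c ^ 2) :=
      le_div_self (sq_nonneg y) h2 (by nlinarith [sq_nonneg c])
    linarith [Real.add_one_le_exp (-(2 * lamc c * y + y ^ 2))]
  have he : (0 : ℝ) ≤ n / 2 - p := by linarith
  calc tiltedWeight c (n * lamc c) (n / 2 - p) (c + y)
      ≤ Real.exp (n * lamc c * y) * Real.exp (-(2 * lamc c * y + y ^ 2)) ^ ((n : ℝ) / 2 - p) := by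
        rw [tiltedWeight, add_sub_cancel_left]
        gcongr
    _ ≤ _ := by
        rw [← Real.exp_mul, ← Real.exp_add, ← Real.exp_add, Real.exp_le_exp, hxy]
        have hy2 : y ≤ 2 := by linarith [hx.2, hc.1]
        have h4 : p * lamc c * y ≤ p * lamc c * 2 := by gcongr
        have h5 : (n : ℝ) / 4 * y ^ 2 ≤ (n / 2 - p) * y ^ 2 := by
          gcongr
          linarith
        nlinarith

lemma sqrt_mul_tiltedFourier {c : ℝ} (N e v : ℝ) {n : ℕ} (hn : 0 < n) :
    ((√(n : ℝ) : ℝ) : ℂ) * tiltedFourier c N e (v * √n) =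
      ∫ x : ℝ, (Set.Ioc (√n * (-1 - c)) (√n * (1 - c))).indicator
        (fun x : ℝ => Complex.exp (Complex.I * (v * x : ℝ)) *
          (tiltedWeight c N e (c + x / √n) : ℂ)) x := by
  have hn' : 0 < √(n : ℝ) := Real.sqrt_pos.2 (Nat.cast_pos.2 hn)
  rw [MeasureTheory.integral_indicator measurableSet_Ioc,
    ← intervalIntegral.integral_of_le (by nlinarith)]
  have h := intervalIntegral.integral_comp_add_div (a := √n * (-1 - c)) (b := √n * (1 - c))
    (fun r : ℝ => Complex.exp (Complex.I * (v * √n * (r - c) : ℝ)) * (tiltedWeight c N e r : ℂ))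
    hn'.ne' c
  rw [show c + √n * (-1 - c) / √n = -1 by field_simp; ring,
    show c + √n * (1 - c) / √n = 1 by field_simp; ring] at h
  rw [tiltedFourier, ← Complex.real_smul, ← h]
  refine intervalIntegral.integral_congr fun x _ => ?_
  rw [show v * √n * (c + x / √n - c) = v * x by field_simp; ring]

lemma tendsto_sqrt_mul_tiltedFourier {c : ℝ} (hc : c ∈ Set.Ioo (0 : ℝ) 1) {p : ℝ} (hp : 0 ≤ p)
    (u : ℝ) :
    Tendsto (fun n : ℕ => ((√(n : ℝ) : ℝ) : ℂ) *
        tiltedFourier c (n * lamc c) (n / 2 - p) (u / sigc c * √n)) atTop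
      (nhds (∫ x : ℝ, Complex.exp (Complex.I * (u / sigc c * x : ℝ)) *
        (Real.exp (-(1 / (2 * sigc c ^ 2)) * x ^ 2) : ℝ))) := by
  have hlarge : ∀ᶠ n : ℕ in atTop, 0 < n ∧ 4 * p ≤ n :=
    (eventually_gt_atTop 0).and (tendsto_natCast_atTop_atTop.eventually_ge_atTop (4 * p))
  have hmem : ∀ {n : ℕ}, 0 < n → ∀ {x : ℝ}, x ∈ Set.Ioc (√n * (-1 - c)) (√n * (1 - c)) ↔
      c + x / √n ∈ Set.Ioc (-1 : ℝ) 1 := by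
    intro n hn x
    have hn' : 0 < √(n : ℝ) := Real.sqrt_pos.2 (Nat.cast_pos.2 hn)
    rw [Set.mem_Ioc, Set.mem_Ioc, ← lt_div_iff₀' hn', ← div_le_iff₀' hn']
    constructor <;> rintro ⟨h, h'⟩ <;> constructor <;> linarith
  refine Tendsto.congr' (f₁ := fun n : ℕ => ∫ x : ℝ,
    (Set.Ioc (√n * (-1 - c)) (√n * (1 - c))).indicator
        (fun x : ℝ => Complex.exp (Complex.I * (u / sigc c * x : ℝ)) *
          (tiltedWeight c (n * lamc c) (n / 2 - p) (c + x / √n) : ℂ)) x) ?_ ?_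
  · filter_upwards [hlarge] with n hn
    exact (sqrt_mul_tiltedFourier _ _ _ hn.1).symm
  refine MeasureTheory.tendsto_integral_filter_of_dominated_convergence
    (fun x => Real.exp (4 * p * lamc c) * Real.exp (-(1 / 4) * x ^ 2)) ?_ ?_
    ((integrable_exp_neg_mul_sq (by norm_num)).const_mul _) ?_
  · filter_upwards [hlarge] with n hn
    refine (Continuous.aestronglyMeasurable ?_).indicator measurableSet_Ioc
    have := (continuous_tiltedWeight c (n * lamc c) (e := n / 2 - p) (by linarith [hn.2])).comp
      (by fun_prop : Continuous fun x : ℝ => c + x / √n)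
    exact (by fun_prop : Continuous fun x : ℝ =>
      Complex.exp (Complex.I * (u / sigc c * x : ℝ))).mul (Complex.continuous_ofReal.comp this)
  · filter_upwards [hlarge] with n hn
    refine Eventually.of_forall fun x => ?_
    by_cases hx : x ∈ Set.Ioc (√n * (-1 - c)) (√n * (1 - c))
    · have hx' := Set.Ioc_subset_Icc_self ((hmem hn.1).1 hx)
      rw [Set.indicator_of_mem hx, norm_mul, norm_cexp_I_mul_ofReal, one_mul, Complex.norm_real,
        Real.norm_of_nonneg (tiltedWeight_nonneg hc _ _ hx')]
      exact tiltedWeight_le hc hp hn.1 hn.2 hx'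
    · rw [Set.indicator_of_notMem hx, norm_zero]
      positivity
  · refine Eventually.of_forall fun x => ?_
    have hy : Tendsto (fun n : ℕ => c + x / √(n : ℝ)) atTop (nhds c) := by
      simpa [div_eq_mul_inv] using (tendsto_inv_sqrt_natCast.const_mul x).const_add c
    refine Tendsto.congr' ?_ (((Complex.continuous_ofReal.tendsto _).comp
      (tendsto_tiltedWeight hc p x)).const_mul (Complex.exp (Complex.I * (u / sigc c * x : ℝ))))
    filter_upwards [hlarge, hy.eventually 
      (Ioc_mem_nhds (by linarith [hc.1] : -1 < c) hc.2)] with n hn hx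
    rw [Set.indicator_of_mem ((hmem hn.1).2 hx)]
    rfl

lemma gaussian_fourier {s : ℝ} (hs : 0 < s) (u : ℝ) :
    ∫ x : ℝ, Complex.exp (Complex.I * (u / s * x : ℝ)) *
        (Real.exp (-(1 / (2 * s ^ 2)) * x ^ 2) : ℝ) =
      (π / (1 / (2 * s ^ 2) : ℝ) : ℂ) ^ (1 / 2 : ℂ) * (Real.exp (-(u ^ 2) / 2) : ℝ) := by
  have hb : 0 < ((1 / (2 * s ^ 2) : ℝ) : ℂ).re := by
    rw [Complex.ofReal_re]
    positivity
  have h := fourierIntegral_gaussian hb ((u / s : ℝ) : ℂ)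
  convert h using 2
  · ext x
    push_cast
    ring_nf
  · rw [Complex.ofReal_exp]
    congr 1
    have : (s : ℂ) ≠ 0 := by exact_mod_cast hs.ne'
    push_cast
    field_simp
    ring

lemma PhiSpher_eq {c : ℝ} (hc : c ∈ Set.Ioo (0 : ℝ) 1) (n : ℕ) (u : ℝ) :
    PhiSpher c n u = tiltedFourier c (n * lamc c) (n / 2 - 2) (u / sigc c * √n) /
      tiltedFourier c (n * lamc c) (n / 2 - 2) 0 := by
  have h2 := one_sub_sq_pos hc
  set K : ℝ := Real.exp (n * lamc c * c) * (1 - c ^ 2) ^ ((n : ℝ) / 2 - 2) with hK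
  have hK0 : (K : ℂ) ≠ 0 := by
    have : 0 < K := by positivity
    exact_mod_cast this.ne'
  have hw : ∀ r ∈ Set.uIcc (-1 : ℝ) 1,
      Real.exp (n * lamc c * r) * (1 - r ^ 2) ^ (((n : ℝ) - 4) / 2) =
        K * tiltedWeight c (n * lamc c) (n / 2 - 2) r := by
    intro r hr
    rw [Set.uIcc_of_le (by norm_num)] at hr
    have hpos : 0 < (1 - c ^ 2) ^ ((n : ℝ) / 2 - 2) := by positivity
    rw [hK, tiltedWeight, Real.div_rpow (by nlinarith [hr.1, hr.2]) h2.le,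
      show ((n : ℝ) - 4) / 2 = n / 2 - 2 by ring,
      show n * lamc c * r = n * lamc c * c + n * lamc c * (r - c) by ring, Real.exp_add]
    field_simp
  rw [PhiSpher, tiltedFourier_zero, intervalIntegral.integral_congr hw,
    intervalIntegral.integral_const_mul, ← intervalIntegral.integral_const_mul, Complex.ofReal_mul]
  rw [← mul_div_mul_left (tiltedFourier c (n * lamc c) (n / 2 - 2) (u / sigc c * √n)) _ hK0]
  congr 1
  rw [tiltedFourier, ← intervalIntegral.integral_const_mul]
  refine intervalIntegral.integral_congr fun r hr => ?_
  have hwr := congrArg (fun z : ℝ => (z : ℂ)) (hw r hr)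
  simp only [Complex.ofReal_mul] at hwr
  rw [mul_left_comm (K : ℂ), ← hwr, Complex.ofReal_exp, ← mul_assoc, ← mul_assoc,
    ← Complex.exp_add, ← Complex.exp_add]
  congr 2
  push_cast
  ring

lemma tendsto_tiltedFourier_div {c : ℝ} (hc : c ∈ Set.Ioo (0 : ℝ) 1) {p : ℝ} (hp : 0 ≤ p) (u : ℝ) :
    Tendsto (fun n : ℕ => tiltedFourier c (n * lamc c) (n / 2 - p) (u / sigc c * √n) /
        tiltedFourier c (n * lamc c) (n / 2 - 2) 0) atTop
      (nhds ((Real.exp (-(u ^ 2) / 2) : ℝ) : ℂ)) := by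
  have hs := sigc_pos hc
  have h1 := tendsto_sqrt_mul_tiltedFourier hc hp u
  have h0 := tendsto_sqrt_mul_tiltedFourier hc (p := 2) (by norm_num) 0
  rw [gaussian_fourier hs] at h1 h0
  set A : ℂ := (π / (1 / (2 * sigc c ^ 2) : ℝ) : ℂ) ^ (1 / 2 : ℂ) with hA
  have hA0 : A ≠ 0 := by
    rw [hA, Complex.cpow_ne_zero_iff]
    left
    have : π / (1 / (2 * sigc c ^ 2)) ≠ 0 := by positivity
    exact_mod_cast this
  have hlim := h1.div h0 (by simpa using hA0)
  have hval : A * (Real.exp (-(u ^ 2) / 2) : ℝ) / (A * (Real.exp (-(0 ^ 2) / 2) : ℝ)) =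
      ((Real.exp (-(u ^ 2) / 2) : ℝ) : ℂ) := by
    rw [mul_div_mul_left _ _ hA0]
    simp
  rw [hval] at hlim
  refine hlim.congr' ?_
  filter_upwards [eventually_gt_atTop 0] with n hn
  have hn' : ((√(n : ℝ) : ℝ) : ℂ) ≠ 0 := by
    exact_mod_cast (Real.sqrt_pos.2 (Nat.cast_pos.2 hn)).ne'
  rw [Pi.div_apply, mul_div_mul_left _ _ hn', zero_div, zero_mul]

lemma norm_PhiSpher_le_one {c : ℝ} (hc : c ∈ Set.Ioo (0 : ℝ) 1) (n : ℕ) (u : ℝ) :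
    ‖PhiSpher c n u‖ ≤ 1 := by
  rw [PhiSpher_eq hc, norm_div]
  exact div_le_one_of_le₀ (norm_tiltedFourier_le hc _ _ _) (norm_nonneg _)

lemma exists_sq_mul_norm_PhiSpher_le {c : ℝ} (hc : c ∈ Set.Ioo (0 : ℝ) 1) :
    ∃ B : ℝ, ∀ᶠ n : ℕ in atTop, ∀ u : ℝ, u ^ 2 * ‖PhiSpher c n u‖ ≤ B := by
  have hs := sigc_pos hc
  have h2 := one_sub_sq_pos hc
  have hlim := (tendsto_tiltedFourier_div hc (p := 4) (by norm_num) 0).norm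
  simp only [zero_div, zero_mul] at hlim
  refine ⟨sigc c ^ 2 * (4 / (1 - c ^ 2) ^ 2) * 2, ?_⟩
  filter_upwards [hlim.eventually_lt_const (u := 2) (by simp), eventually_gt_atTop 10]
    with n hn hn10 u
  have hn10' : (10 : ℝ) < n := by exact_mod_cast hn10
  have key := sq_mul_norm_tiltedFourier_le hc (n * lamc c) (u / sigc c * √n) (e := n / 2 - 2)
    (by linarith)
  rw [show (n : ℝ) / 2 - 2 - 2 = n / 2 - 4 by ring, mul_pow, Real.sq_sqrt n.cast_nonneg] at key
  rw [PhiSpher_eq hc, norm_div]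
  rw [norm_div] at hn
  set X := ‖tiltedFourier c (n * lamc c) (n / 2 - 2) (u / sigc c * √n)‖
  set D := ‖tiltedFourier c (n * lamc c) (n / 2 - 2) 0‖
  set J := ‖tiltedFourier c (n * lamc c) (n / 2 - 4) 0‖
  have hJ : 0 ≤ J := norm_nonneg _
  have hX : u ^ 2 * X ≤ sigc c ^ 2 * (4 / (1 - c ^ 2) ^ 2) * J := by
    have hn0 : (0 : ℝ) < n := by linarith
    have h3 : (8 : ℝ) * (n / 2 - 2) / (1 - c ^ 2) ^ 2 * J ≤ n * (4 / (1 - c ^ 2) ^ 2) * J := by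
      refine mul_le_mul_of_nonneg_right ?_ hJ
      rw [mul_div_assoc']
      exact div_le_div_of_nonneg_right (by linarith) (by positivity)
    have h4 := mul_le_mul_of_nonneg_left (key.trans h3) (by positivity : 0 ≤ sigc c ^ 2 / n)
    calc u ^ 2 * X = sigc c ^ 2 / n * ((u / sigc c) ^ 2 * n * X) := by field_simp
      _ ≤ _ := h4
      _ = _ := by field_simp
  calc u ^ 2 * (X / D) = u ^ 2 * X / D := by ring
    _ ≤ sigc c ^ 2 * (4 / (1 - c ^ 2) ^ 2) * J / D := by
        gcongr
    _ = sigc c ^ 2 * (4 / (1 - c ^ 2) ^ 2) * (J / D) := by ring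
    _ ≤ _ := by gcongr

lemma continuous_PhiSpher {c : ℝ} (hc : c ∈ Set.Ioo (0 : ℝ) 1) {n : ℕ} (hn : 4 ≤ n) :
    Continuous (PhiSpher c n) := by
  have hn' : (4 : ℝ) ≤ n := by exact_mod_cast hn
  have hw := continuous_tiltedWeight c (n * lamc c) (e := n / 2 - 2) (by linarith)
  have : PhiSpher c n = fun u => _ := funext fun u => PhiSpher_eq hc n u
  rw [this]
  refine Continuous.div_const ?_ _
  unfold tiltedFourier
  refine intervalIntegral.continuous_parametric_intervalIntegral_of_continuous' ?_ _ _
  unfold Function.uncurry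
  fun_prop

lemma one_le_norm_one_add_I_mul (a : ℝ) : 1 ≤ ‖1 + Complex.I * a‖ := by
  simpa using Complex.abs_re_le_norm (1 + Complex.I * a)

theorem stmt_6 (c : ℝ) (hc : c ∈ Set.Ioo (0 : ℝ) 1) :
    (∀ u : ℝ,
      Tendsto (fun n : ℕ => PhiSpher c n u) atTop
        (nhds ((Real.exp (-(u ^ 2) / 2) : ℝ) : ℂ))) ∧
    Tendsto
      (fun n : ℕ =>
        ((Real.sqrt (2 * π) : ℝ) : ℂ)⁻¹ *
          ∫ u : ℝ,
            (1 + Complex.I * u / (lamc c * sigc c * Real.sqrt n))⁻¹ * PhiSpher c n u)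
      atTop (nhds 1) := by
  have hpt : ∀ u : ℝ, Tendsto (fun n : ℕ => PhiSpher c n u) atTop
      (nhds ((Real.exp (-(u ^ 2) / 2) : ℝ) : ℂ)) := fun u => by
    simp only [PhiSpher_eq hc]
    exact tendsto_tiltedFourier_div hc (by norm_num) u
  refine ⟨hpt, ?_⟩
  obtain ⟨B, hB⟩ := exists_sq_mul_norm_PhiSpher_le hc
  have hfac : ∀ (n : ℕ) (u : ℝ), 1 + Complex.I * u / (lamc c * sigc c * Real.sqrt n) =
      1 + Complex.I * (u * (√(n : ℝ))⁻¹ / (lamc c * sigc c) : ℝ) := fun n u => by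
    push_cast
    ring
  have hlim : Tendsto (fun n : ℕ => ∫ u : ℝ,
      (1 + Complex.I * u / (lamc c * sigc c * Real.sqrt n))⁻¹ * PhiSpher c n u) atTop
      (nhds (∫ u : ℝ, ((Real.exp (-(u ^ 2) / 2) : ℝ) : ℂ))) := by
    refine MeasureTheory.tendsto_integral_filter_of_dominated_convergence
      (fun u => (1 + B) * (1 + u ^ 2)⁻¹) ?_ ?_ (integrable_inv_one_add_sq.const_mul _) ?_
    · filter_upwards [eventually_ge_atTop 4] with n hn
      have h1 : Measurable fun u : ℝ =>
          (1 + Complex.I * u / (lamc c * sigc c * Real.sqrt n))⁻¹ := by fun_prop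
      exact h1.aestronglyMeasurable.mul (continuous_PhiSpher hc hn).aestronglyMeasurable
    · filter_upwards [hB] with n hn
      refine Eventually.of_forall fun u => ?_
      rw [norm_mul, norm_inv, hfac, ← div_eq_mul_inv (1 + B), le_div_iff₀ (by positivity)]
      have h1 := inv_le_one_of_one_le₀
        (one_le_norm_one_add_I_mul (u * (√(n : ℝ))⁻¹ / (lamc c * sigc c)))
      have h2 := mul_le_of_le_one_left (norm_nonneg (PhiSpher c n u)) h1
      calc _ ≤ ‖PhiSpher c n u‖ * (1 + u ^ 2) := by gcongr
        _ ≤ 1 + B := by linarith [hn u, norm_PhiSpher_le_one hc n u]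
    · refine Eventually.of_forall fun u => ?_
      have h1 : Tendsto (fun n : ℕ => u * (√(n : ℝ))⁻¹ / (lamc c * sigc c)) atTop (nhds 0) := by
        simpa using (tendsto_inv_sqrt_natCast.const_mul u).div_const (lamc c * sigc c)
      have h2 := (((Complex.continuous_ofReal.tendsto _).comp h1).const_mul
        Complex.I).const_add (1 : ℂ)
      have h3 := (h2.inv₀ (by simp)).mul (hpt u)
      simp only [hfac]
      simpa using h3
  have hgauss : ∫ u : ℝ, ((Real.exp (-(u ^ 2) / 2) : ℝ) : ℂ) = ((√(2 * π) : ℝ) : ℂ) := by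
    rw [integral_complex_ofReal]
    have h := integral_gaussian (1 / 2)
    rw [show π / (1 / 2) = 2 * π by ring] at h
    rw [← h]
    congr 2 with u
    ring_nf
  rw [hgauss] at hlim
  have h0 : ((√(2 * π) : ℝ) : ℂ) ≠ 0 := by
    have : √(2 * π) ≠ 0 := by positivity
    exact_mod_cast this
  have h := hlim.const_mul ((√(2 * π) : ℝ) : ℂ)⁻¹
  rwa [inv_mul_cancel₀ h0] at h
end

section
/- Let ρ ∈ (-1,1) and λ ∈ ℝ, and define h̄_λ(r) = λr - log(1-ρr) + (1/2) log(1-r²) for r ∈ (-1,1). Then (i) the equation h̄_λ'(r) = 0 has at least one solution r ∈ (-1,1); and (ii) the second derivative h̄_λ''(r) = ρ²/(1-ρr)² - (1+r²)/(1-r²)² (which does not depend on λ) satisfies h̄_λ''(r) ≤ 0 for every r ∈ (-1,1) if and only if |ρ| ≤ ρ_0, where ρ_0 = √(3+2√3)/3. -/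
open Real Filter

/-- The phase function `h̄_λ(r) = λr - log(1-ρr) + (1/2) log(1-r²)`. -/
noncomputable def hbar (ρ lam r : ℝ) : ℝ :=
  lam * r - Real.log (1 - ρ * r) + (1 / 2) * Real.log (1 - r ^ 2)

theorem one_sub_mul_pos_of_mem_Ioo {ρ r : ℝ} (hρ : ρ ∈ Set.Ioo (-1 : ℝ) 1)
    (hr : r ∈ Set.Ioo (-1 : ℝ) 1) : 0 < 1 - ρ * r := by
  obtain ⟨h1, h2⟩ := hρ
  obtain ⟨h3, h4⟩ := hr
  nlinarith [mul_pos (sub_pos.2 h1) (sub_pos.2 h4), mul_pos (sub_pos.2 h2) (sub_pos.2 h3)]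

theorem one_sub_sq_pos_of_mem_Ioo {r : ℝ} (hr : r ∈ Set.Ioo (-1 : ℝ) 1) : 0 < 1 - r ^ 2 := by
  obtain ⟨h3, h4⟩ := hr
  nlinarith

theorem hasDerivAt_hbar {ρ r : ℝ} (lam : ℝ) (hρ : ρ ∈ Set.Ioo (-1 : ℝ) 1)
    (hr : r ∈ Set.Ioo (-1 : ℝ) 1) :
    HasDerivAt (hbar ρ lam) (lam + ρ / (1 - ρ * r) - r / (1 - r ^ 2)) r := by
  have h1 := (one_sub_mul_pos_of_mem_Ioo hρ hr).ne'
  have h2 := (one_sub_sq_pos_of_mem_Ioo hr).ne'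
  have d1 : HasDerivAt (fun x : ℝ => 1 - ρ * x) (-(ρ * 1)) r :=
    ((hasDerivAt_id r).const_mul ρ).const_sub 1
  have d2 : HasDerivAt (fun x : ℝ => 1 - x ^ 2) (-(2 * r)) r := by
    simpa using (hasDerivAt_pow 2 r).const_sub 1
  have d := (((hasDerivAt_id r).const_mul lam).sub (d1.log h1)).add ((d2.log h2).const_mul (1 / 2))
  refine HasDerivAt.congr_deriv d ?_
  field_simp
  ring

theorem hasDerivAt_deriv_hbar {ρ r : ℝ} (lam : ℝ) (hρ : ρ ∈ Set.Ioo (-1 : ℝ) 1)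
    (hr : r ∈ Set.Ioo (-1 : ℝ) 1) :
    HasDerivAt (deriv (hbar ρ lam))
      (ρ ^ 2 / (1 - ρ * r) ^ 2 - (1 + r ^ 2) / (1 - r ^ 2) ^ 2) r := by
  have h1 := (one_sub_mul_pos_of_mem_Ioo hρ hr).ne'
  have h2 := (one_sub_sq_pos_of_mem_Ioo hr).ne'
  have d1 : HasDerivAt (fun x : ℝ => 1 - ρ * x) (-(ρ * 1)) r :=
    ((hasDerivAt_id r).const_mul ρ).const_sub 1
  have d2 : HasDerivAt (fun x : ℝ => 1 - x ^ 2) (-(2 * r)) r := by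
    simpa using (hasDerivAt_pow 2 r).const_sub 1
  have d := (((hasDerivAt_const r ρ).div d1 h1).const_add lam).sub ((hasDerivAt_id r).div d2 h2)
  have heq : deriv (hbar ρ lam) =ᶠ[nhds r]
      fun x => lam + ρ / (1 - ρ * x) - x / (1 - x ^ 2) := by
    filter_upwards [isOpen_Ioo.mem_nhds hr] with x hx using (hasDerivAt_hbar lam hρ hx).deriv
  refine HasDerivAt.congr_of_eventuallyEq (HasDerivAt.congr_deriv d ?_) heq
  simp only [id]
  field_simp
  ring

theorem exists_hbar_critical_point {ρ : ℝ} (lam : ℝ) (hρ : ρ ∈ Set.Ioo (-1 : ℝ) 1) :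
    ∃ r ∈ Set.Ioo (-1 : ℝ) 1, lam + ρ / (1 - ρ * r) - r / (1 - r ^ 2) = 0 := by
  have hc : ContinuousOn
      (fun r : ℝ => (lam * (1 - ρ * r) + ρ) * (1 - r ^ 2) - r * (1 - ρ * r)) (Set.Icc (-1) 1) := by
    fun_prop
  obtain ⟨r, hr, h⟩ := intermediate_value_Ioo' (by norm_num) hc
    (show (0 : ℝ) ∈ Set.Ioo _ _ by constructor <;> norm_num <;> linarith [hρ.1, hρ.2])
  have h1 := (one_sub_mul_pos_of_mem_Ioo hρ hr).ne'
  have h2 := (one_sub_sq_pos_of_mem_Ioo hr).ne'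
  refine ⟨r, hr, ?_⟩
  dsimp only at h
  field_simp
  linear_combination h

/-- The second derivative of `hbar` is nonpositive exactly when this square-root form holds. -/
theorem second_deriv_nonpos_iff {ρ r : ℝ} (hρ : ρ ∈ Set.Ioo (-1 : ℝ) 1)
    (hr : r ∈ Set.Ioo (-1 : ℝ) 1) :
    ρ ^ 2 / (1 - ρ * r) ^ 2 - (1 + r ^ 2) / (1 - r ^ 2) ^ 2 ≤ 0 ↔
      |ρ| * (1 - r ^ 2) ≤ √(1 + r ^ 2) * (1 - ρ * r) := by
  have h1 := one_sub_mul_pos_of_mem_Ioo hρ hr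
  have h2 := one_sub_sq_pos_of_mem_Ioo hr
  rw [sub_nonpos, div_le_div_iff₀ (by positivity) (by positivity),
    ← sq_le_sq₀ (a := |ρ| * (1 - r ^ 2)) (by positivity) (by positivity), mul_pow, mul_pow, sq_abs,
    Real.sq_sqrt (by positivity)]

/-- With `u = r + √(1 + r²)` the gap is a positive multiple of
`u³ - 3 c u² + u + c = (u - √3 c)² (u + c (2 √3 - 3))`. -/
theorem mul_one_sub_sq_le_of_le_threshold {p c r : ℝ} (hc : 0 < c) (hc2 : 9 * c ^ 2 = 3 + 2 * √3)
    (hp : 0 ≤ p) (hpc : p ≤ c) : p * (1 - r ^ 2) ≤ √(1 + r ^ 2) * (1 - p * r) := by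
  have hs : √(1 + r ^ 2) ^ 2 = 1 + r ^ 2 := Real.sq_sqrt (by positivity)
  have hs0 : 0 < √(1 + r ^ 2) := Real.sqrt_pos.2 (by positivity)
  generalize √(1 + r ^ 2) = s at hs hs0 ⊢
  have hk : √3 ^ 2 = (3 : ℝ) := Real.sq_sqrt (by norm_num)
  have hk0 : 0 ≤ √3 := Real.sqrt_nonneg 3
  generalize √3 = k at hk hk0 hc2
  have hk1 : 0 < 2 * k - 3 := by nlinarith
  have hu : 0 < s + r := by nlinarith
  have hthr : 0 ≤ s - c * (1 - r ^ 2 + r * s) := by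
    have key : 2 * (s + r) ^ 2 * (s - c * (1 - r ^ 2 + r * s)) =
        ((s + r) - k * c) ^ 2 * ((s + r) + c * (2 * k - 3)) := by
      linear_combination ((s + r) - c * (2 * (s + r) ^ 2 - 1 - 2 * (s + r) * s)) * hs -
        (s + r) * (-3 * c ^ 2 * hk + (2 * k - 3) / 3 * hc2 + 4 / 3 * hk) -
        c * (c ^ 2 * (2 * k - 3) * hk + (2 * k - 3) / 3 * hc2 + 4 / 3 * hk)
    have : 0 ≤ 2 * (s + r) ^ 2 * (s - c * (1 - r ^ 2 + r * s)) := by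
      rw [key]; positivity
    exact nonneg_of_mul_nonneg_right this (by positivity)
  rcases le_total 0 (1 - r ^ 2 + r * s) with h | h
  · nlinarith [mul_le_mul_of_nonneg_right hpc h]
  · nlinarith [mul_nonneg hp (neg_nonneg.2 h)]

theorem exists_threshold_witness {c : ℝ} (hc : 0 < c) (hc2 : 9 * c ^ 2 = 3 + 2 * √3) :
    ∃ r ∈ Set.Ioo (0 : ℝ) 1, ∀ p : ℝ,
      p * (1 - r ^ 2) ≤ √(1 + r ^ 2) * (1 - p * r) → p ≤ c := by
  have hk : √3 ^ 2 = (3 : ℝ) := Real.sq_sqrt (by norm_num)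
  have hk0 : 0 ≤ √3 := Real.sqrt_nonneg 3
  generalize √3 = k at hk hk0 hc2
  have hk1 : 1 < k := by nlinarith
  have hk2 : k < 2 := by nlinarith
  have hr2 : (k * c * (2 - k)) ^ 2 = 2 * k / 3 - 1 := by
    linear_combination k ^ 2 * (2 - k) ^ 2 / 9 * hc2 +
      (2 * k ^ 3 - 5 * k ^ 2 + 2 * k - 3) / 9 * hk
  have hs : √(1 + (k * c * (2 - k)) ^ 2) = k * c * (k - 1) := by
    rw [Real.sqrt_eq_iff_mul_self_eq_of_pos
      (mul_pos (mul_pos (by linarith) hc) (sub_pos.2 hk1)), hr2]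
    linear_combination k ^ 2 * (k - 1) ^ 2 / 9 * hc2 + (2 * k ^ 3 - k ^ 2 + 2 * k) / 9 * hk
  have hr0 : 0 < k * c * (2 - k) := mul_pos (mul_pos (by linarith) hc) (sub_pos.2 hk2)
  refine ⟨k * c * (2 - k), ⟨hr0, by nlinarith⟩, fun p h => ?_⟩
  rw [hs, hr2] at h
  have h' : p * (3 - k) ≤ c * (3 - k) := by
    have hX : k ^ 2 * c ^ 2 * ((k - 1) * (2 - k)) = (3 - k) / 3 := by
      linear_combination k ^ 2 * ((k - 1) * (2 - k)) / 9 * hc2 +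
        (-2 * k ^ 3 + 3 * k ^ 2 - k + 3) / 9 * hk
    linear_combination h - p * hX + c * hk
  exact le_of_mul_le_mul_right h' (by linarith)

theorem stmt_9 (ρ lam : ℝ) (hρ : ρ ∈ Set.Ioo (-1 : ℝ) 1) :
    (∀ r ∈ Set.Ioo (-1 : ℝ) 1,
        deriv (hbar ρ lam) r = lam + ρ / (1 - ρ * r) - r / (1 - r ^ 2) ∧
        deriv (deriv (hbar ρ lam)) r
          = ρ ^ 2 / (1 - ρ * r) ^ 2 - (1 + r ^ 2) / (1 - r ^ 2) ^ 2) ∧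
    (∃ r ∈ Set.Ioo (-1 : ℝ) 1, lam + ρ / (1 - ρ * r) - r / (1 - r ^ 2) = 0) ∧
    ((∀ r ∈ Set.Ioo (-1 : ℝ) 1,
        ρ ^ 2 / (1 - ρ * r) ^ 2 - (1 + r ^ 2) / (1 - r ^ 2) ^ 2 ≤ 0) ↔
      |ρ| ≤ Real.sqrt (3 + 2 * Real.sqrt 3) / 3) := by
  refine ⟨fun r hr => ⟨(hasDerivAt_hbar lam hρ hr).deriv, (hasDerivAt_deriv_hbar lam hρ hr).deriv⟩,
    exists_hbar_critical_point lam hρ, ?_⟩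
  have hc : 0 < √(3 + 2 * √3) / 3 := by positivity
  have hc2 : 9 * (√(3 + 2 * √3) / 3) ^ 2 = 3 + 2 * √3 := by
    rw [div_pow, Real.sq_sqrt (by positivity)]
    ring
  constructor
  · intro h
    obtain ⟨r, ⟨hr0, hr1⟩, hr⟩ := exists_threshold_witness hc hc2
    apply hr
    rcases abs_cases ρ with ⟨ha, -⟩ | ⟨ha, -⟩
    · have hmem : r ∈ Set.Ioo (-1 : ℝ) 1 := ⟨by linarith, hr1⟩
      simpa only [ha] using (second_deriv_nonpos_iff hρ hmem).1 (h r hmem)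
    · have hmem : -r ∈ Set.Ioo (-1 : ℝ) 1 := ⟨by linarith, by linarith⟩
      simpa only [ha, neg_sq, mul_neg, neg_mul] using
        (second_deriv_nonpos_iff hρ hmem).1 (h (-r) hmem)
  · intro h r hr
    rw [second_deriv_nonpos_iff hρ hr]
    rcases abs_cases ρ with ⟨ha, -⟩ | ⟨ha, -⟩
    · simpa only [ha] using
        mul_one_sub_sq_le_of_le_threshold (r := r) hc hc2 (abs_nonneg ρ) h
    · simpa only [ha, neg_sq, mul_neg, neg_mul, neg_neg] using
        mul_one_sub_sq_le_of_le_threshold (r := -r) hc hc2 (abs_nonneg ρ) h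
end
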